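/- Let d ≥ 2 and assume a complete set of d+1 mutually unbiased bases exists in ℂ^d, with complete MUB ensemble M. Let S be any labelled union of d+1 orthonormal bases of ℂ^d (counting basis membership with multiplicity). Then W(S) ≤ W(M), where W denotes the isotropic random-Hamiltonian Gaussian width: no union of d+1 orthonormal bases has larger expected random-Hamiltonian maximum than the complete MUB ensemble. -/

import Mathlib

open MeasureTheory ProbabilityTheory Matrix

noncomputable section

/-- The centered projection `Q_ψ = |ψ⟩⟨ψ| − I/d` associated to a vector `ψ ∈ ℂ^d`. -/
def Qmat {d : ℕ} (ψ : Fin d → ℂ) : Matrix (Fin d) (Fin d) ℂ :=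
  Matrix.vecMulVec ψ (star ψ) - (d : ℂ)⁻¹ • (1 : Matrix (Fin d) (Fin d) ℂ)

/-- `B` is an orthonormal basis of `ℂ^d` (as a `d`-tuple of vectors). -/
def IsONB {d : ℕ} (B : Fin d → Fin d → ℂ) : Prop :=
  ∀ i j, star (B i) ⬝ᵥ B j = if i = j then (1 : ℂ) else 0

/-- `B` is a complete system of `d+1` mutually unbiased bases of `ℂ^d`. -/
def IsCompleteMUB {d : ℕ} (B : Fin (d + 1) → Fin d → Fin d → ℂ) : Prop :=
  (∀ a, IsONB (B a)) ∧
    ∀ a b i j, a ≠ b → Complex.normSq (star (B a i) ⬝ᵥ B b j) = 1 / d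

/-- `H` is a standard isotropic Gaussian Hamiltonian on `ℂ^d` under the probability
measure `μ`: it is `∑ k, g k • E k` for an orthonormal basis `E` of the real space of
traceless Hermitian `d×d` matrices (Hilbert–Schmidt inner product) and i.i.d. standard
real Gaussians `g k`. -/
def IsStdGaussianHamiltonian {d : ℕ} {Ω : Type*} [MeasurableSpace Ω]
    (μ : Measure Ω) (H : Ω → Matrix (Fin d) (Fin d) ℂ) : Prop :=
  ∃ (E : Fin (d ^ 2 - 1) → Matrix (Fin d) (Fin d) ℂ)
    (g : Fin (d ^ 2 - 1) → Ω → ℝ),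
      (∀ k, (E k).IsHermitian) ∧
      (∀ k, (E k).trace = 0) ∧
      (∀ k l, (E k * E l).trace = if k = l then (1 : ℂ) else 0) ∧
      Measurable (fun ω k => g k ω) ∧
      Measure.map (fun ω k => g k ω) μ =
        Measure.pi (fun _ : Fin (d ^ 2 - 1) => gaussianReal 0 1) ∧
      ∀ ω, H ω = ∑ k, (g k ω : ℂ) • E k

open scoped ENNReal RealInnerProductSpace

/-- One-dimensional Brunn–Minkowski inequality for midpoints of compact sets. -/
lemma volume_add_le_two_mul_of_isCompact {A B C : Set ℝ} (hA : IsCompact A) (hB : IsCompact B)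
    (hA0 : A.Nonempty) (hB0 : B.Nonempty) (h : ∀ x ∈ A, ∀ y ∈ B, (x + y) / 2 ∈ C) :
    volume A + volume B ≤ 2 * volume C := by
  obtain ⟨a, haA, ha⟩ := hA.exists_isGreatest hA0
  obtain ⟨b, hbB, hb⟩ := hB.exists_isLeast hB0
  have hC : volume ((fun z : ℝ => z * (1 / 2)) ⁻¹' C) = 2 * volume C := by
    rw [Real.volume_preimage_mul_right (by norm_num)]
    norm_num
  rw [← hC]
  have hA' : volume ((fun z : ℝ => z - b) ⁻¹' A) = volume A := by
    simp [sub_eq_add_neg]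
  have hB' : volume ((fun z : ℝ => z - a) ⁻¹' B) = volume B := by
    simp [sub_eq_add_neg]
  rw [← hA', ← hB', ← measure_union₀ (hB.measurableSet.preimage (by fun_prop)).nullMeasurableSet]
  · apply measure_mono
    rintro z (hz | hz)
    · have := h _ hz _ hbB
      simp only [Set.mem_preimage]
      convert this using 1
      ring
    · have := h _ haA _ hz
      simp only [Set.mem_preimage]
      convert this using 1
      ring
  · refine measure_mono_null (t := {a + b}) ?_ (by simp)
    rintro z ⟨hz1, hz2⟩
    have h1 := ha hz1
    have h2 := hb hz2
    simp only [Set.mem_singleton_iff]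
    linarith

/-- One-dimensional Brunn–Minkowski inequality for midpoints of measurable sets. -/
lemma volume_add_le_two_mul {A B C : Set ℝ} (hA : MeasurableSet A) (hB : MeasurableSet B)
    (hA0 : A.Nonempty) (hB0 : B.Nonempty) (h : ∀ x ∈ A, ∀ y ∈ B, (x + y) / 2 ∈ C) :
    volume A + volume B ≤ 2 * volume C := by
  obtain ⟨a, ha⟩ := hA0
  obtain ⟨b, hb⟩ := hB0
  rw [hA.measure_eq_iSup_isCompact, hB.measure_eq_iSup_isCompact]
  simp only [iSup_and']
  refine ENNReal.biSup_add_biSup_le' (p := fun K => K ⊆ A ∧ IsCompact K)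
    (q := fun K => K ⊆ B ∧ IsCompact K) ⟨∅, by simp⟩ ⟨∅, by simp⟩ ?_
  rintro K ⟨hKA, hK⟩ L ⟨hLB, hL⟩
  calc volume K + volume L ≤ volume (insert a K) + volume (insert b L) :=
        add_le_add (measure_mono (Set.subset_insert _ _)) (measure_mono (Set.subset_insert _ _))
    _ ≤ 2 * volume C := by
        refine volume_add_le_two_mul_of_isCompact (hK.insert a) (hL.insert b)
          (Set.insert_nonempty _ _) (Set.insert_nonempty _ _) ?_
        intro x hx y hy
        exact h x (Set.insert_subset ha hKA hx) y (Set.insert_subset hb hLB hy)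

lemma ENNReal.mul_le_half_add_sq (x y : ℝ≥0∞) : 4 * (x * y) ≤ (x + y) ^ 2 := by
  by_cases hx : x = ∞
  · simp [hx]
  by_cases hy : y = ∞
  · simp [hy]
  lift x to NNReal using hx
  lift y to NNReal using hy
  norm_cast
  rw [← NNReal.coe_le_coe]
  push_cast
  nlinarith [sq_nonneg ((x : ℝ) - y)]

/-- Prékopa–Leindler on the line for functions with essential height one. -/
lemma lintegral_add_lintegral_le_of_height_one {f g h : ℝ → ℝ} (hf : Measurable f)
    (hg : Measurable g) (hh : Measurable h) (hf0 : ∀ x, 0 ≤ f x) (hg0 : ∀ x, 0 ≤ g x)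
    (hh0 : ∀ x, 0 ≤ h x) (hf1 : ∀ x, f x ≤ 1) (hg1 : ∀ x, g x ≤ 1)
    (hfs : ∀ t < 1, ∃ x, t < f x) (hgs : ∀ t < 1, ∃ x, t < g x)
    (hfg : ∀ x y, f x * g y ≤ h ((x + y) / 2) ^ 2) :
    (∫⁻ x, ENNReal.ofReal (f x)) + ∫⁻ x, ENNReal.ofReal (g x)
      ≤ 2 * ∫⁻ x, ENNReal.ofReal (h x) := by
  rw [lintegral_eq_lintegral_meas_lt _ (Filter.Eventually.of_forall hf0) hf.aemeasurable,
    lintegral_eq_lintegral_meas_lt _ (Filter.Eventually.of_forall hg0) hg.aemeasurable,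
    lintegral_eq_lintegral_meas_lt _ (Filter.Eventually.of_forall hh0) hh.aemeasurable,
    ← lintegral_const_mul' _ _ (by simp), ← lintegral_add_left]
  · refine setLIntegral_mono' measurableSet_Ioi fun t ht => ?_
    rcases lt_or_ge t 1 with h1 | h1
    · refine volume_add_le_two_mul (measurableSet_lt measurable_const hf)
        (measurableSet_lt measurable_const hg) (hfs t h1) (hgs t h1) ?_
      intro x hx y hy
      simp only [Set.mem_ofPred_eq, Set.mem_Ioi] at *
      have := hfg x y
      by_contra! hcon
      nlinarith [hh0 ((x + y) / 2)]
    · have e1 : {a | t < f a} = ∅ := by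
        ext a; simpa using (hf1 a).trans h1
      have e2 : {a | t < g a} = ∅ := by
        ext a; simpa using (hg1 a).trans h1
      simp [e1, e2]
  · exact Antitone.measurable fun s t hst =>
      measure_mono fun ω hω => lt_of_le_of_lt hst hω

lemma exists_height {f : ℝ → ℝ≥0∞} {k : ℝ≥0∞} (hk : k ≠ ∞) (hf : ∀ x, f x ≤ k)
    (h0 : ∫⁻ x, f x ≠ 0) :
    ∃ m : ℝ, 0 < m ∧ (∀ x, f x ≤ ENNReal.ofReal m) ∧ ∀ t < 1, ∃ x, t < (f x).toReal / m := by
  have hM : (⨆ x, f x) ≠ ∞ := ne_top_of_le_ne_top hk (iSup_le hf)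
  have hM0 : (⨆ x, f x) ≠ 0 := by
    intro h
    apply h0
    have : ∀ x, f x = 0 := fun x => le_antisymm (h ▸ le_iSup f x) bot_le
    simp [this]
  refine ⟨(⨆ x, f x).toReal, ENNReal.toReal_pos hM0 hM, fun x => ?_, fun t ht => ?_⟩
  · rw [ENNReal.ofReal_toReal hM]
    exact le_iSup f x
  · have hpos := ENNReal.toReal_pos hM0 hM
    have : ENNReal.ofReal (t * (⨆ x, f x).toReal) < ⨆ x, f x := by
      have := (ENNReal.ofReal_lt_ofReal_iff hpos).2
        (show t * (⨆ x, f x).toReal < (⨆ x, f x).toReal by nlinarith)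
      rwa [ENNReal.ofReal_toReal hM] at this
    obtain ⟨x, hx⟩ := lt_iSup_iff.1 this
    refine ⟨x, ?_⟩
    rw [lt_div_iff₀ hpos]
    by_contra! hcon
    exact absurd hx (not_lt.2 ((ENNReal.le_ofReal_iff_toReal_le
      (ne_top_of_le_ne_top hk (hf x)) (le_trans ENNReal.toReal_nonneg hcon)).2 hcon))

lemma lintegral_eq_ofReal_mul {f : ℝ → ℝ≥0∞} (hf : Measurable f) (hf' : ∀ x, f x ≠ ∞) {m : ℝ}
    (hm : 0 < m) :
    ∫⁻ x, f x = ENNReal.ofReal m * ∫⁻ x, ENNReal.ofReal ((f x).toReal / m) := by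
  rw [← lintegral_const_mul _ (by fun_prop)]
  refine lintegral_congr fun x => ?_
  rw [← ENNReal.ofReal_mul hm.le, mul_div_cancel₀ _ hm.ne', ENNReal.ofReal_toReal (hf' x)]

lemma lintegral_mul_le_sq_of_bounded {f g h : ℝ → ℝ≥0∞} (hf : Measurable f)
    (hg : Measurable g) (hh : Measurable h) {k : ℝ≥0∞} (hk : k ≠ ∞) (hfk : ∀ x, f x ≤ k)
    (hgk : ∀ x, g x ≤ k) (hhk : ∀ x, h x ≤ k)
    (hfg : ∀ x y, f x * g y ≤ h ((x + y) / 2) ^ 2) :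
    (∫⁻ x, f x) * ∫⁻ x, g x ≤ (∫⁻ x, h x) ^ 2 := by
  by_cases hf0 : ∫⁻ x, f x = 0
  · simp [hf0]
  by_cases hg0 : ∫⁻ x, g x = 0
  · simp [hg0]
  obtain ⟨m, hm, hfm, hfs⟩ := exists_height hk hfk hf0
  obtain ⟨n, hn, hgn, hgs⟩ := exists_height hk hgk hg0
  have hft := fun x => ne_top_of_le_ne_top hk (hfk x)
  have hgt := fun x => ne_top_of_le_ne_top hk (hgk x)
  have hht := fun x => ne_top_of_le_ne_top hk (hhk x)
  have hmn : 0 < √(m * n) := Real.sqrt_pos.2 (mul_pos hm hn)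
  have key := lintegral_add_lintegral_le_of_height_one (f := fun x => (f x).toReal / m)
    (g := fun x => (g x).toReal / n) (h := fun x => (h x).toReal / √(m * n))
    (by fun_prop) (by fun_prop) (by fun_prop) (fun x => by positivity) (fun x => by positivity)
    (fun x => by positivity)
    (fun x => (div_le_one hm).2 (ENNReal.toReal_le_of_le_ofReal hm.le (hfm x)))
    (fun x => (div_le_one hn).2 (ENNReal.toReal_le_of_le_ofReal hn.le (hgn x)))
    hfs hgs (fun x y => by
      rw [div_pow, Real.sq_sqrt (by positivity), div_mul_div_comm]
      gcongr
      rw [← ENNReal.toReal_mul, ← ENNReal.toReal_pow]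
      exact ENNReal.toReal_mono (by simp [hht]) (hfg x y))
  rw [lintegral_eq_ofReal_mul hf hft hm, lintegral_eq_ofReal_mul hg hgt hn,
    lintegral_eq_ofReal_mul hh hht hmn, mul_mul_mul_comm, ← ENNReal.ofReal_mul hm.le, mul_pow,
    ← ENNReal.ofReal_pow hmn.le, Real.sq_sqrt (by positivity)]
  gcongr
  have h4 := (ENNReal.mul_le_half_add_sq _ _).trans (pow_le_pow_left' key 2)
  rw [mul_pow, show (2 : ℝ≥0∞) ^ 2 = 4 by norm_num] at h4
  exact (ENNReal.mul_le_mul_iff_right (by norm_num) (by norm_num)).1 h4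

/-- The Prékopa–Leindler inequality on the line, for midpoints. -/
lemma lintegral_mul_le_sq {f g h : ℝ → ℝ≥0∞} (hf : Measurable f)
    (hg : Measurable g) (hh : Measurable h)
    (hfg : ∀ x y, f x * g y ≤ h ((x + y) / 2) ^ 2) :
    (∫⁻ x, f x) * ∫⁻ x, g x ≤ (∫⁻ x, h x) ^ 2 := by
  have hsup : ∀ {f : ℝ → ℝ≥0∞}, Measurable f →
      ∫⁻ x, f x = ⨆ k : ℕ, ∫⁻ x, min (f x) k := by
    intro f hf
    rw [← lintegral_iSup (f := fun (k : ℕ) x => min (f x) (k : ℝ≥0∞))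
      (fun k => hf.min measurable_const)
      (fun i j hij x => min_le_min le_rfl (by exact_mod_cast hij))]
    refine lintegral_congr fun x => ?_
    rw [← inf_iSup_eq, ENNReal.iSup_natCast, inf_top_eq]
  rw [hsup hf, hsup hg, ENNReal.iSup_mul]
  refine iSup_le fun i => ?_
  rw [ENNReal.mul_iSup]
  refine iSup_le fun j => ?_
  have key := lintegral_mul_le_sq_of_bounded (f := fun x => min (f x) i) (g := fun x => min (g x) j)
    (h := fun x => min (h x) (max i j : ℕ)) (hf.min measurable_const) (hg.min measurable_const)
    (hh.min measurable_const) (k := (max i j : ℕ)) (by simp)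
    (fun x => (min_le_right _ _).trans (by exact_mod_cast le_max_left _ _))
    (fun x => (min_le_right _ _).trans (by exact_mod_cast le_max_right _ _))
    (fun x => min_le_right _ _) (fun x y => ?_)
  · refine key.trans ?_
    gcongr
    exact min_le_left _ _
  · rcases le_total (h ((x + y) / 2)) (max i j : ℕ) with h1 | h1
    · rw [min_eq_left h1]
      exact (mul_le_mul' (min_le_left _ _) (min_le_left _ _)).trans (hfg x y)
    · rw [min_eq_right h1, sq]
      exact mul_le_mul' ((min_le_right _ _).trans (by exact_mod_cast le_max_left _ _))
        ((min_le_right _ _).trans (by exact_mod_cast le_max_right _ _))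

lemma lintegral_gaussianReal_mul_le_sq {f g h : ℝ → ℝ≥0∞} (hf : Measurable f)
    (hg : Measurable g) (hh : Measurable h)
    (hfg : ∀ x y, f x * g y ≤ h ((x + y) / 2) ^ 2 * ENNReal.ofReal (Real.exp ((x - y) ^ 2 / 4))) :
    (∫⁻ x, f x ∂(gaussianReal 0 1)) * ∫⁻ x, g x ∂(gaussianReal 0 1)
      ≤ (∫⁻ x, h x ∂(gaussianReal 0 1)) ^ 2 := by
  have hm : Measurable (gaussianPDF 0 1) := measurable_gaussianPDF 0 1
  simp only [gaussianReal_of_var_ne_zero 0 one_ne_zero]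
  rw [lintegral_withDensity_eq_lintegral_mul _ hm hf,
    lintegral_withDensity_eq_lintegral_mul _ hm hg,
    lintegral_withDensity_eq_lintegral_mul _ hm hh]
  refine lintegral_mul_le_sq (hm.mul hf) (hm.mul hg) (hm.mul hh) fun x y => ?_
  simp only [Pi.mul_apply]
  rw [mul_mul_mul_comm]
  refine (mul_le_mul_right (hfg x y) _).trans (le_of_eq ?_)
  rw [mul_comm (h _ ^ 2), ← mul_assoc, mul_pow]
  congr 1
  simp only [gaussianPDF]
  rw [← ENNReal.ofReal_mul (gaussianPDFReal_nonneg _ _ _),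
    ← ENNReal.ofReal_mul (by
      have := gaussianPDFReal_nonneg 0 1
      exact mul_nonneg (this x) (this y)),
    ← ENNReal.ofReal_pow (gaussianPDFReal_nonneg _ _ _)]
  congr 1
  simp only [gaussianPDFReal]
  rw [mul_pow, sq (Real.exp _), ← Real.exp_add, mul_mul_mul_comm, mul_assoc, ← Real.exp_add,
    ← Real.exp_add, ← sq]
  congr 2
  simp only [NNReal.coe_one]
  ring

lemma lintegral_pi_gaussianReal_mul_le_sq (n : ℕ) {f g h : (Fin n → ℝ) → ℝ≥0∞} (hf : Measurable f)
    (hg : Measurable g) (hh : Measurable h)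
    (hfg : ∀ x y, f x * g y ≤ h (fun i => (x i + y i) / 2) ^ 2 *
      ENNReal.ofReal (Real.exp ((∑ i, (x i - y i) ^ 2) / 4))) :
    (∫⁻ x, f x ∂(Measure.pi fun _ => gaussianReal 0 1)) *
        ∫⁻ x, g x ∂(Measure.pi fun _ => gaussianReal 0 1)
      ≤ (∫⁻ x, h x ∂(Measure.pi fun _ => gaussianReal 0 1)) ^ 2 := by
  induction n with
  | zero =>
    have : ∀ (f : (Fin 0 → ℝ) → ℝ≥0∞), ∫⁻ x, f x ∂(Measure.pi fun _ => gaussianReal 0 1) = f 0 := by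
      intro f
      refine (lintegral_congr fun x => congrArg f (Subsingleton.elim x 0)).trans ?_
      rw [lintegral_const, measure_univ, mul_one]
    rw [this, this, this]
    have := hfg 0 0
    rw [Subsingleton.elim (fun i : Fin 0 => ((0 : Fin 0 → ℝ) i + (0 : Fin 0 → ℝ) i) / 2) 0] at this
    simpa using this
  | succ n ih =>
    have e := fun (f : (Fin (n + 1) → ℝ) → ℝ≥0∞) (hf : Measurable f) =>
      show ∫⁻ x, f x ∂(Measure.pi fun _ => gaussianReal 0 1) =
        ∫⁻ s, ∫⁻ x, f (Fin.cons s x) ∂(Measure.pi fun _ => gaussianReal 0 1)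
          ∂(gaussianReal 0 1) from by
      rw [← (measurePreserving_piFinSuccAbove (fun _ => gaussianReal 0 1) 0).symm.lintegral_comp hf,
        lintegral_prod _ (by fun_prop)]
      simp [MeasurableEquiv.piFinSuccAbove, Fin.insertNthEquiv]
    have hmc : Measurable fun p : ℝ × (Fin n → ℝ) => (Fin.cons p.1 p.2 : Fin (n + 1) → ℝ) := by
      refine measurable_pi_lambda _ fun i => ?_
      refine Fin.cases ?_ (fun j => ?_) i <;> simp <;> fun_prop
    have hmi := fun (f : (Fin (n + 1) → ℝ) → ℝ≥0∞) (hf : Measurable f) =>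
      (Measurable.lintegral_prod_right' (ν := Measure.pi fun _ : Fin n => gaussianReal 0 1)
        (hf.comp hmc))
    have hms : ∀ f : (Fin (n + 1) → ℝ) → ℝ≥0∞, Measurable f → ∀ s : ℝ,
        Measurable fun x : Fin n → ℝ => f (Fin.cons s x) := fun f hf s =>
      (hf.comp hmc).comp (measurable_prodMk_left (x := s))
    rw [e f hf, e g hg, e h hh]
    refine lintegral_gaussianReal_mul_le_sq (hmi f hf) (hmi g hg) (hmi h hh) fun s t => ?_
    have key := ih (f := fun x => f (Fin.cons s x)) (g := fun x => g (Fin.cons t x))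
      (h := fun x => ENNReal.ofReal (Real.exp ((s - t) ^ 2 / 8)) * h (Fin.cons ((s + t) / 2) x))
      (hms f hf s) (hms g hg t) ((hms h hh _).const_mul _) (fun x y => by
        refine (hfg _ _).trans (le_of_eq ?_)
        have : (fun i => ((Fin.cons s x : Fin (n + 1) → ℝ) i + (Fin.cons t y : Fin (n + 1) → ℝ) i) / 2)
            = (Fin.cons ((s + t) / 2) fun i => (x i + y i) / 2 : Fin (n + 1) → ℝ) := by
          ext i
          refine Fin.cases ?_ (fun j => ?_) i <;> simp
        rw [this, mul_pow, mul_comm (_ ^ 2) (h _ ^ 2), mul_assoc,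
          ← ENNReal.ofReal_pow (by positivity), ← ENNReal.ofReal_mul (by positivity),
          ← Real.exp_nat_mul, ← Real.exp_add, Fin.sum_univ_succ]
        simp only [Fin.cons_zero, Fin.cons_succ]
        congr 4
        push_cast
        ring)
    refine key.trans (le_of_eq ?_)
    rw [lintegral_const_mul _ (hms h hh _), mul_pow, ← ENNReal.ofReal_pow (by positivity),
      ← Real.exp_nat_mul, mul_comm, show ((2 : ℕ) : ℝ) * ((s - t) ^ 2 / 8) = (s - t) ^ 2 / 4 by
        push_cast; ring]

/-- A strengthened Prékopa–Leindler inequality for the standard Gaussian measure. -/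
lemma lintegral_stdGaussian_mul_le_sq {E : Type*} [NormedAddCommGroup E] [InnerProductSpace ℝ E]
    [FiniteDimensional ℝ E] [MeasurableSpace E] [BorelSpace E]
    {f g h : E → ℝ≥0∞} (hf : Measurable f) (hg : Measurable g) (hh : Measurable h)
    (hfg : ∀ x y, f x * g y ≤ h ((2⁻¹ : ℝ) • (x + y)) ^ 2 *
      ENNReal.ofReal (Real.exp (‖x - y‖ ^ 2 / 4))) :
    (∫⁻ x, f x ∂(stdGaussian E)) * ∫⁻ x, g x ∂(stdGaussian E) ≤
      (∫⁻ x, h x ∂(stdGaussian E)) ^ 2 := by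
  set b := stdOrthonormalBasis ℝ E
  rw [stdGaussian]
  have hmm : Measurable fun x : Fin (Module.finrank ℝ E) → ℝ => ∑ i, x i • b i := by fun_prop
  rw [lintegral_map hf hmm, lintegral_map hg hmm, lintegral_map hh hmm]
  refine lintegral_pi_gaussianReal_mul_le_sq _ (hf.comp hmm) (hg.comp hmm) (hh.comp hmm)
    fun x y => ?_
  refine (hfg _ _).trans (le_of_eq ?_)
  congr 3
  · simp only [Finset.smul_sum, ← Finset.sum_add_distrib, ← add_smul, smul_smul]
    congr 1; ext i; congr 1; ring
  · rw [← Finset.sum_sub_distrib]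
    simp only [← sub_smul]
    rw [← b.sum_sq_norm_inner_right]
    simp [b.orthonormal.inner_right_fintype]

section Doubling

variable {ι α : Type*} [DecidableEq α]

/-- The vector with the coordinates of `x` in block `a` and those of `y` in the other blocks. -/
def blockMix (b : ι → α) (a : α) (x y : EuclideanSpace ℝ ι) : EuclideanSpace ℝ ι :=
  WithLp.toLp 2 fun i => if b i = a then x i else y i

@[simp] lemma blockMix_apply (b : ι → α) (a : α) (x y : EuclideanSpace ℝ ι) (i : ι) :
    blockMix b a x y i = if b i = a then x i else y i := rfl

lemma blockMix_add (b : ι → α) (a : α) (x y x' y' : EuclideanSpace ℝ ι) :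
    blockMix b a x y + blockMix b a x' y' = blockMix b a (x + x') (y + y') := by
  ext i; by_cases h : b i = a <;> simp [h]

lemma blockMix_sub (b : ι → α) (a : α) (x y x' y' : EuclideanSpace ℝ ι) :
    blockMix b a x y - blockMix b a x' y' = blockMix b a (x - x') (y - y') := by
  ext i; by_cases h : b i = a <;> simp [h]

lemma blockMix_smul (b : ι → α) (a : α) (c : ℝ) (x y : EuclideanSpace ℝ ι) :
    c • blockMix b a x y = blockMix b a (c • x) (c • y) := by
  ext i; by_cases h : b i = a <;> simp [h]

lemma blockMix_self (b : ι → α) (a : α) (x : EuclideanSpace ℝ ι) : blockMix b a x x = x := by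
  ext i; simp

/-- The value at `(u, v)` of `F ⊗ F` rotated by an angle `π / 4`. -/
def rotSlice (F : EuclideanSpace ℝ ι → ℝ≥0∞) (u v : EuclideanSpace ℝ ι) : ℝ≥0∞ :=
  F ((√2)⁻¹ • (u + v)) * F ((√2)⁻¹ • (u - v))

lemma rotSlice_neg (F : EuclideanSpace ℝ ι → ℝ≥0∞) (u v : EuclideanSpace ℝ ι) :
    rotSlice F u (-v) = rotSlice F u v := by
  simp [rotSlice, mul_comm, sub_eq_add_neg]

lemma rotSlice_neg_left {F : EuclideanSpace ℝ ι → ℝ≥0∞} (hF : ∀ x, F (-x) = F x)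
    (u v : EuclideanSpace ℝ ι) :
    rotSlice F (-u) v = rotSlice F u v := by
  rw [rotSlice, rotSlice, mul_comm, ← hF, ← hF ((√2)⁻¹ • (-u + v)), ← smul_neg, ← smul_neg]
  congr 3 <;> abel

/-- Midpoint log-concave functions bounded by one that are products over blocks of coordinates
(expressed by invariance of `F x * F y` under exchanging a block between `x` and `y`). -/
structure IsBlockLogConcave (b : ι → α) (F : EuclideanSpace ℝ ι → ℝ≥0∞) : Prop where
  measurable : Measurable F
  le_one : ∀ x, F x ≤ 1
  mul_le_sq : ∀ x y, F x * F y ≤ F ((2⁻¹ : ℝ) • (x + y)) ^ 2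
  mul_eq : ∀ a x y, F x * F y = F (blockMix b a x y) * F (blockMix b a y x)

lemma rotSlice_mul_rotSlice_le {b : ι → α} {F : EuclideanSpace ℝ ι → ℝ≥0∞}
    (hF : IsBlockLogConcave b F) (u u' v v' : EuclideanSpace ℝ ι) :
    rotSlice F u v * rotSlice F u' v' ≤
      rotSlice F ((2⁻¹ : ℝ) • (u + u')) ((2⁻¹ : ℝ) • (v + v')) ^ 2 := by
  unfold rotSlice
  rw [mul_mul_mul_comm, mul_pow]
  refine (mul_le_mul' (hF.mul_le_sq _ _) (hF.mul_le_sq _ _)).trans (le_of_eq ?_)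
  congr 3 <;> module

lemma rotSlice_mul_rotSlice_eq {b : ι → α} {F : EuclideanSpace ℝ ι → ℝ≥0∞}
    (hF : IsBlockLogConcave b F) (a : α) (u u' v v' : EuclideanSpace ℝ ι) :
    rotSlice F u v * rotSlice F u' v' =
      rotSlice F (blockMix b a u u') (blockMix b a v v') *
        rotSlice F (blockMix b a u' u) (blockMix b a v' v) := by
  simp only [rotSlice, blockMix_add, blockMix_sub, blockMix_smul]
  rw [mul_mul_mul_comm, hF.mul_eq a ((√2)⁻¹ • (u + v)), hF.mul_eq a ((√2)⁻¹ • (u - v)),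
    mul_mul_mul_comm]

lemma measurable_blockMix (b : ι → α) (a : α) :
    Measurable fun p : EuclideanSpace ℝ ι × EuclideanSpace ℝ ι => blockMix b a p.1 p.2 := by
  refine (WithLp.measurable_toLp 2 _).comp (measurable_pi_lambda _ fun i => ?_)
  split_ifs <;> fun_prop

variable [Fintype ι]

/-- The doubling operator: the Gaussian average of the rotated `F ⊗ F` in the second variable. -/
def double (F : EuclideanSpace ℝ ι → ℝ≥0∞) (u : EuclideanSpace ℝ ι) : ℝ≥0∞ :=
  ∫⁻ v, rotSlice F u v ∂(stdGaussian (EuclideanSpace ℝ ι))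

lemma measurable_rotSlice {F : EuclideanSpace ℝ ι → ℝ≥0∞} (hF : Measurable F) :
    Measurable fun p : EuclideanSpace ℝ ι × EuclideanSpace ℝ ι => rotSlice F p.1 p.2 := by
  unfold rotSlice
  exact (hF.comp (by fun_prop)).mul (hF.comp (by fun_prop))

lemma double_neg {F : EuclideanSpace ℝ ι → ℝ≥0∞} (hF : ∀ x, F (-x) = F x)
    (u : EuclideanSpace ℝ ι) : double F (-u) = double F u := by
  simp [double, rotSlice_neg_left hF]

lemma IsBlockLogConcave.rotSlice {b : ι → α} {F : EuclideanSpace ℝ ι → ℝ≥0∞}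
    (hF : IsBlockLogConcave b F) (u : EuclideanSpace ℝ ι) :
    IsBlockLogConcave b (rotSlice F u) where
  measurable := (measurable_rotSlice hF.measurable).comp measurable_prodMk_left
  le_one v := mul_le_one' (hF.le_one _) (hF.le_one _)
  mul_le_sq v w := by
    convert rotSlice_mul_rotSlice_le hF u u v w using 3
    module
  mul_eq a v w := by
    simpa [blockMix_self] using rotSlice_mul_rotSlice_eq hF a u u v w

lemma norm_sq_strongDual (L : StrongDual ℝ (EuclideanSpace ℝ ι)) [DecidableEq ι] :
    ‖L‖ ^ 2 = ∑ i, (L (EuclideanSpace.single i 1)) ^ 2 := by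
  rw [← ((InnerProductSpace.toDual ℝ _).symm).norm_map L, EuclideanSpace.norm_sq_eq]
  refine Finset.sum_congr rfl fun i _ => ?_
  have h := InnerProductSpace.toDual_symm_apply (x := EuclideanSpace.single i (1 : ℝ)) (y := L)
  rw [EuclideanSpace.inner_single_right] at h
  rw [← h]
  simp

/-- Exchanging a block of coordinates preserves the product Gaussian measure. -/
lemma map_blockMix_prod (b : ι → α) (a : α) :
    ((stdGaussian (EuclideanSpace ℝ ι)).prod (stdGaussian (EuclideanSpace ℝ ι))).map
      (fun p => (blockMix b a p.1 p.2, blockMix b a p.2 p.1)) =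
    (stdGaussian (EuclideanSpace ℝ ι)).prod (stdGaussian (EuclideanSpace ℝ ι)) := by
  classical
  let T : (EuclideanSpace ℝ ι × EuclideanSpace ℝ ι) →L[ℝ]
      (EuclideanSpace ℝ ι × EuclideanSpace ℝ ι) := LinearMap.toContinuousLinearMap
    { toFun := fun p => (blockMix b a p.1 p.2, blockMix b a p.2 p.1)
      map_add' := fun p q => by simp [blockMix_add]
      map_smul' := fun c p => by simp [blockMix_smul] }
  change Measure.map T _ = _
  refine Measure.ext_of_charFunDual (funext fun L => ?_)
  rw [charFunDual_map, charFunDual_prod, charFunDual_prod]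
  simp only [charFunDual_stdGaussian, ← Complex.exp_add]
  congr 1
  have : ‖(L.comp T).comp (ContinuousLinearMap.inl ℝ (EuclideanSpace ℝ ι) (EuclideanSpace ℝ ι))‖ ^ 2 +
      ‖(L.comp T).comp (ContinuousLinearMap.inr ℝ (EuclideanSpace ℝ ι) (EuclideanSpace ℝ ι))‖ ^ 2 =
      ‖L.comp (ContinuousLinearMap.inl ℝ (EuclideanSpace ℝ ι) (EuclideanSpace ℝ ι))‖ ^ 2 +
      ‖L.comp (ContinuousLinearMap.inr ℝ (EuclideanSpace ℝ ι) (EuclideanSpace ℝ ι))‖ ^ 2 := by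
    simp only [norm_sq_strongDual, ← Finset.sum_add_distrib]
    refine Finset.sum_congr rfl fun i _ => ?_
    have hT : ∀ p, T p = (blockMix b a p.1 p.2, blockMix b a p.2 p.1) := fun p => rfl
    simp only [ContinuousLinearMap.comp_apply, ContinuousLinearMap.inl_apply,
      ContinuousLinearMap.inr_apply, hT]
    by_cases h : b i = a
    · have e1 : blockMix b a (EuclideanSpace.single i (1 : ℝ)) 0 = EuclideanSpace.single i 1 := by
        ext j; by_cases hj : j = i <;> simp [hj, h]
      have e2 : blockMix b a 0 (EuclideanSpace.single i (1 : ℝ)) = 0 := by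
        ext j; by_cases hj : j = i <;> simp [hj, h]
      rw [e1, e2]
    · have e1 : blockMix b a (EuclideanSpace.single i (1 : ℝ)) 0 = 0 := by
        ext j; by_cases hj : j = i <;> simp [hj, h]
      have e2 : blockMix b a 0 (EuclideanSpace.single i (1 : ℝ)) = EuclideanSpace.single i 1 := by
        ext j; by_cases hj : j = i <;> simp [hj, h]
      rw [e1, e2, add_comm]
  have := congrArg (fun x : ℝ => (x : ℂ)) this
  push_cast at this
  linear_combination (-1 / 2 : ℂ) * this

lemma IsBlockLogConcave.double {b : ι → α} {F : EuclideanSpace ℝ ι → ℝ≥0∞}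
    (hF : IsBlockLogConcave b F) : IsBlockLogConcave b (double F) where
  measurable := Measurable.lintegral_prod_right' (measurable_rotSlice hF.measurable)
  le_one u := by
    refine (lintegral_mono fun v => (hF.rotSlice u).le_one v).trans ?_
    simp
  mul_le_sq u u' := by
    refine lintegral_stdGaussian_mul_le_sq (hF.rotSlice u).measurable (hF.rotSlice u').measurable
      (hF.rotSlice _).measurable fun v v' => ?_
    refine (rotSlice_mul_rotSlice_le hF u u' v v').trans ?_
    refine le_mul_of_one_le_right (zero_le) ?_
    simp only [ENNReal.one_le_ofReal]
    exact Real.one_le_exp (by positivity)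
  mul_eq a u u' := by
    have e : ∀ u u', _root_.double F u * _root_.double F u' =
        ∫⁻ p : EuclideanSpace ℝ ι × EuclideanSpace ℝ ι, _root_.rotSlice F u p.1 *
          _root_.rotSlice F u' p.2
          ∂((stdGaussian (EuclideanSpace ℝ ι)).prod (stdGaussian (EuclideanSpace ℝ ι))) :=
      fun u u' => (lintegral_prod_mul (hF.rotSlice u).measurable.aemeasurable
        (hF.rotSlice u').measurable.aemeasurable).symm
    rw [e, e]
    symm
    nth_rw 1 [← map_blockMix_prod b a]
    rw [lintegral_map]
    · exact lintegral_congr fun p => (rotSlice_mul_rotSlice_eq hF a _ _ _ _).symm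
    · exact ((hF.rotSlice _).measurable.comp measurable_fst).mul
        ((hF.rotSlice _).measurable.comp measurable_snd)
    · exact (measurable_blockMix b a).prodMk ((measurable_blockMix b a).comp measurable_swap)

end Doubling

lemma inv_sqrt_two_smul_add_sub {V : Type*} [AddCommGroup V] [Module ℝ V] (u v : V) :
    (√2)⁻¹ • ((√2)⁻¹ • (u + v) + (√2)⁻¹ • (u - v)) = u := by
  rw [← smul_add, smul_smul, ← mul_inv, Real.mul_self_sqrt (by norm_num)]
  module

section Rotation

variable {V : Type*} [NormedAddCommGroup V] [InnerProductSpace ℝ V] [FiniteDimensional ℝ V]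
  [MeasurableSpace V] [BorelSpace V]

/-- Rotation invariance of the square of a centered Gaussian measure. -/
lemma lintegral_prod_rotate (μ : Measure V) [IsGaussian μ] (hμ : μ[id] = 0) {G : V × V → ℝ≥0∞}
    (hG : Measurable G) :
    ∫⁻ u, ∫⁻ v, G ((√2)⁻¹ • (u + v), (√2)⁻¹ • (u - v)) ∂μ ∂μ = ∫⁻ p, G p ∂(μ.prod μ) := by
  have := FiniteDimensional.proper ℝ V
  have h := IsGaussian.map_rotation_eq_self hμ (Real.pi / 4)
  nth_rw 1 [← h]
  rw [lintegral_map hG (by fun_prop), lintegral_prod_symm _ (by fun_prop)]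
  refine lintegral_congr fun u => lintegral_congr fun v => ?_
  have hc : √2 / 2 = (√2)⁻¹ := by
    rw [div_eq_iff (by norm_num), inv_mul_eq_div, eq_div_iff (by positivity)]
    norm_num
  simp only [ContinuousLinearMap.rotation_apply, Real.cos_pi_div_four, Real.sin_pi_div_four, hc]
  congr 2 <;> module

end Rotation

section Normalized

variable {ι α : Type*} [DecidableEq α] [Fintype ι]

/-- The probability measure with density proportional to `F` relative to the standard Gaussian. -/
def gaussTilt (F : EuclideanSpace ℝ ι → ℝ≥0∞) : Measure (EuclideanSpace ℝ ι) :=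
  (∫⁻ x, F x ∂(stdGaussian (EuclideanSpace ℝ ι)))⁻¹ •
    (stdGaussian (EuclideanSpace ℝ ι)).withDensity F

lemma lintegral_gaussTilt {F G : EuclideanSpace ℝ ι → ℝ≥0∞} (hF : Measurable F)
    (hG : Measurable G) :
    ∫⁻ x, G x ∂(gaussTilt F) = (∫⁻ x, F x ∂(stdGaussian (EuclideanSpace ℝ ι)))⁻¹ *
      ∫⁻ x, F x * G x ∂(stdGaussian (EuclideanSpace ℝ ι)) := by
  rw [gaussTilt, lintegral_smul_measure, lintegral_withDensity_eq_lintegral_mul _ hF hG]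
  rfl

lemma IsBlockLogConcave.lintegral_le_one {b : ι → α} {F : EuclideanSpace ℝ ι → ℝ≥0∞}
    (hF : IsBlockLogConcave b F) : ∫⁻ x, F x ∂(stdGaussian (EuclideanSpace ℝ ι)) ≤ 1 := by
  refine (lintegral_mono hF.le_one).trans ?_
  simp

lemma IsBlockLogConcave.isProbabilityMeasure {b : ι → α} {F : EuclideanSpace ℝ ι → ℝ≥0∞}
    (hF : IsBlockLogConcave b F) (h0 : ∫⁻ x, F x ∂(stdGaussian (EuclideanSpace ℝ ι)) ≠ 0) :
    IsProbabilityMeasure (gaussTilt F) := by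
  constructor
  rw [← lintegral_one, lintegral_gaussTilt hF.measurable measurable_const]
  simp only [mul_one]
  exact ENNReal.inv_mul_cancel h0 (ne_top_of_le_ne_top (by simp) hF.lintegral_le_one)

lemma lintegral_mul_double {F G : EuclideanSpace ℝ ι → ℝ≥0∞} (hF : Measurable F)
    (hG : Measurable G) :
    ∫⁻ u, G u * double F u ∂(stdGaussian (EuclideanSpace ℝ ι)) =
      ∫⁻ x, ∫⁻ y, G ((√2)⁻¹ • (x + y)) * (F x * F y) ∂(stdGaussian (EuclideanSpace ℝ ι))
        ∂(stdGaussian (EuclideanSpace ℝ ι)) := by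
  have hm : Measurable fun p : EuclideanSpace ℝ ι × EuclideanSpace ℝ ι =>
      G ((√2)⁻¹ • (p.1 + p.2)) * (F p.1 * F p.2) :=
    (hG.comp (by fun_prop)).mul ((hF.comp (by fun_prop)).mul (hF.comp (by fun_prop)))
  rw [← lintegral_prod (fun p : EuclideanSpace ℝ ι × EuclideanSpace ℝ ι =>
    G ((√2)⁻¹ • (p.1 + p.2)) * (F p.1 * F p.2)) hm.aemeasurable,
    ← lintegral_prod_rotate _ (integral_id_stdGaussian) hm]
  refine lintegral_congr fun u => ?_
  simp only [inv_sqrt_two_smul_add_sub]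
  rw [lintegral_const_mul]
  · rfl
  · exact (measurable_rotSlice hF).comp measurable_prodMk_left

lemma lintegral_double {F : EuclideanSpace ℝ ι → ℝ≥0∞} (hF : Measurable F) :
    ∫⁻ u, double F u ∂(stdGaussian (EuclideanSpace ℝ ι)) =
      (∫⁻ x, F x ∂(stdGaussian (EuclideanSpace ℝ ι))) ^ 2 := by
  have := lintegral_mul_double (G := fun _ => 1) hF measurable_const
  simp only [one_mul] at this
  rw [this, sq, lintegral_lintegral_mul hF.aemeasurable hF.aemeasurable]

/-- The tilted measure of the doubled function is the law of a normalised sum. -/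
lemma gaussTilt_double {b : ι → α} {F : EuclideanSpace ℝ ι → ℝ≥0∞}
    (hF : IsBlockLogConcave b F) (h0 : ∫⁻ x, F x ∂(stdGaussian (EuclideanSpace ℝ ι)) ≠ 0) :
    gaussTilt (double F) = ((gaussTilt F) ∗ (gaussTilt F)).map ((√2)⁻¹ • ·) := by
  have := hF.isProbabilityMeasure h0
  refine Measure.ext_of_lintegral _ fun G hG => ?_
  have htop := ne_top_of_le_ne_top (by simp) hF.lintegral_le_one
  rw [lintegral_map hG (by fun_prop), Measure.lintegral_conv (by fun_prop),
    lintegral_gaussTilt hF.double.measurable hG, lintegral_double hF.measurable]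
  simp only [mul_comm (double F _)]
  rw [lintegral_mul_double hF.measurable hG]
  have e : ∀ x, ∫⁻ y, G ((√2)⁻¹ • (x + y)) ∂(gaussTilt F) = _ := fun x =>
    lintegral_gaussTilt hF.measurable (G := fun y => G ((√2)⁻¹ • (x + y))) (by fun_prop)
  have hm : Measurable fun p : EuclideanSpace ℝ ι × EuclideanSpace ℝ ι =>
      F p.2 * G ((√2)⁻¹ • (p.1 + p.2)) := (hF.measurable.comp (by fun_prop)).mul (by fun_prop)
  simp only [e]
  rw [lintegral_gaussTilt hF.measurable (hm.lintegral_prod_right'.const_mul _), sq,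
    ENNReal.mul_inv (Or.inl h0) (Or.inl htop), mul_assoc, ← lintegral_const_mul _ (by
      refine Measurable.lintegral_prod_right' (f := fun p => G ((√2)⁻¹ • (p.1 + p.2)) *
        (F p.1 * F p.2)) ?_
      exact (hG.comp (by fun_prop)).mul ((hF.measurable.comp (by fun_prop)).mul
        (hF.measurable.comp (by fun_prop))))]
  congr 1
  refine lintegral_congr fun x => ?_
  have hFm := hF.measurable
  rw [mul_left_comm]
  congr 1
  rw [← lintegral_const_mul _ (by fun_prop)]
  refine lintegral_congr fun y => ?_
  ring

end Normalized

lemma one_add_sq_div_two_le_cosh (x : ℝ) : 1 + x ^ 2 / 2 ≤ Real.cosh x := by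
  have h : Real.cosh x = 1 + 2 * Real.sinh (x / 2) ^ 2 := by
    have h1 := Real.cosh_two_mul (x / 2)
    rw [mul_div_cancel₀ x (two_ne_zero)] at h1
    rw [h1, Real.cosh_sq]
    ring
  have h2 : (x / 2) ^ 2 ≤ Real.sinh (x / 2) ^ 2 := by
    rcases le_total 0 (x / 2) with h0 | h0
    · have := Real.self_le_sinh_iff.2 h0
      nlinarith
    · have := Real.sinh_le_self_iff.2 h0
      nlinarith
  rw [h]
  nlinarith

lemma integral_sq_le_of_hasSubgaussianMGF {Ω : Type*} [MeasurableSpace Ω] {μ : Measure Ω}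
    [IsProbabilityMeasure μ] {X : Ω → ℝ} {c : NNReal} (h : HasSubgaussianMGF X c μ) :
    ∫ ω, X ω ^ 2 ∂μ ≤ c := by
  have hint : Integrable (fun ω => X ω ^ 2) μ := (h.memLp 2).integrable_sq
  set E := ∫ ω, X ω ^ 2 ∂μ with hE
  have key : ∀ t : ℝ, 1 + t ^ 2 / 2 * E ≤ Real.exp (c * t ^ 2 / 2) := by
    intro t
    have h1 := h.mgf_le t
    have h2 := h.mgf_le (-t)
    rw [neg_sq] at h2
    have h3 : ∫ ω, (1 + t ^ 2 / 2 * X ω ^ 2) ∂μ ≤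
        ∫ ω, (Real.exp (t * X ω) + Real.exp (-t * X ω)) / 2 ∂μ := by
      refine integral_mono ((integrable_const _).add (hint.const_mul _))
        (((h.integrable_exp_mul t).add (h.integrable_exp_mul (-t))).div_const 2) fun ω => ?_
      have := one_add_sq_div_two_le_cosh (t * X ω)
      rw [Real.cosh_eq] at this
      simp only [neg_mul]
      linarith [mul_pow t (X ω) 2]
    rw [integral_add (integrable_const _) (hint.const_mul _), integral_const_mul,
      integral_div, integral_add (h.integrable_exp_mul t) (h.integrable_exp_mul (-t))] at h3
    simp only [integral_const, probReal_univ, smul_eq_mul, mul_one] at h3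
    simp only [mgf] at h1 h2
    linarith
  by_contra! hcon
  have hE0 : 0 < E := lt_of_le_of_lt c.2 hcon
  have hlim : Filter.Tendsto (fun y : ℝ => (Real.exp (c * y) - 1) / y) (nhdsWithin 0 (Set.Ioi 0))
      (nhds c) := by
    have hd : HasDerivAt (fun y : ℝ => Real.exp (c * y)) c 0 := by
      simpa using ((hasDerivAt_id (0 : ℝ)).const_mul (c : ℝ)).exp
    have := hd.tendsto_slope_zero_right
    simpa [div_eq_inv_mul] using this
  refine absurd (ge_of_tendsto hlim ?_) (not_le.2 hcon)
  filter_upwards [self_mem_nhdsWithin] with y (hy : 0 < y)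
  rw [le_div_iff₀ hy]
  have := key (√(2 * y))
  rw [Real.sq_sqrt (by positivity)] at this
  have e : (c : ℝ) * (2 * y) / 2 = c * y := by ring
  rw [e] at this
  linarith

lemma norm_charFun_sub_le_of_hasSubgaussianMGF {Ω : Type*} [MeasurableSpace Ω] {μ : Measure Ω}
    [IsProbabilityMeasure μ] {X : Ω → ℝ} {c : NNReal} (h : HasSubgaussianMGF X c μ)
    (h0 : ∫ ω, X ω ∂μ = 0) {s : ℝ} (hs0 : 0 ≤ s) (hs1 : s ≤ 1) :
    ‖∫ ω, Complex.exp ((s * X ω : ℝ) * Complex.I) ∂μ -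
      (1 - ((s ^ 2 * ∫ ω, X ω ^ 2 ∂μ : ℝ) : ℂ) / 2)‖
      ≤ 12 * Real.exp (2 * c) * s ^ 3 := by
  have hint2 : Integrable (fun ω => X ω ^ 2) μ := (h.memLp 2).integrable_sq
  have hX := h.aemeasurable
  have hexp : Integrable (fun ω => Complex.exp ((s * X ω : ℝ) * Complex.I)) μ := by
    refine Integrable.of_bound (by fun_prop) 1 (Filter.Eventually.of_forall fun ω => ?_)
    rw [Complex.norm_exp_ofReal_mul_I]
  have hp : ∀ ω, ‖Complex.exp ((s * X ω : ℝ) * Complex.I) -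
      (1 + ((s * X ω : ℝ) : ℂ) * Complex.I - ((s ^ 2 * X ω ^ 2 : ℝ) : ℂ) / 2)‖ ≤
      6 * s ^ 3 * (Real.exp (2 * X ω) + Real.exp (-2 * X ω)) := by
    intro ω
    have h1 := Complex.norm_exp_sub_sum_le_norm_mul_exp ((s * X ω : ℝ) * Complex.I) 3
    have e : ∑ m ∈ Finset.range 3, (((s * X ω : ℝ) : ℂ) * Complex.I) ^ m / (m.factorial : ℂ) =
        1 + ((s * X ω : ℝ) : ℂ) * Complex.I - ((s ^ 2 * X ω ^ 2 : ℝ) : ℂ) / 2 := by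
      simp [Finset.sum_range_succ, Nat.factorial, mul_pow, sub_eq_add_neg, neg_div]
    rw [e] at h1
    refine h1.trans ?_
    simp only [norm_mul, Complex.norm_I, mul_one, Complex.norm_real, Real.norm_eq_abs, mul_pow,
      abs_of_nonneg hs0]
    have h2 : |X ω| ^ 3 ≤ 6 * Real.exp |X ω| := by
      have := Real.pow_div_factorial_le_exp |X ω| (abs_nonneg _) 3
      rw [div_le_iff₀ (by positivity)] at this
      norm_num [Nat.factorial] at this
      linarith
    have h3 : Real.exp (s * |X ω|) ≤ Real.exp |X ω| :=
      Real.exp_le_exp.2 (mul_le_of_le_one_left (abs_nonneg _) hs1)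
    have h4 : Real.exp |X ω| * Real.exp |X ω| ≤ Real.exp (2 * X ω) + Real.exp (-2 * X ω) := by
      rw [← Real.exp_add]
      rcases abs_cases (X ω) with ⟨h, _⟩ | ⟨h, _⟩ <;> rw [h]
      · rw [← two_mul]; linarith [Real.exp_pos (-2 * X ω)]
      · rw [← two_mul, mul_neg, ← neg_mul]; linarith [Real.exp_pos (2 * X ω)]
    calc s ^ 3 * |X ω| ^ 3 * Real.exp (s * |X ω|)
        ≤ s ^ 3 * (6 * Real.exp |X ω|) * Real.exp |X ω| := by gcongr
      _ = 6 * s ^ 3 * (Real.exp |X ω| * Real.exp |X ω|) := by ring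
      _ ≤ _ := by gcongr
  have hI : ∫ ω, (1 + ((s * X ω : ℝ) : ℂ) * Complex.I - ((s ^ 2 * X ω ^ 2 : ℝ) : ℂ) / 2) ∂μ =
      1 - ((s ^ 2 * ∫ ω, X ω ^ 2 ∂μ : ℝ) : ℂ) / 2 := by
    have i1 : Integrable (fun ω => ((s * X ω : ℝ) : ℂ) * Complex.I) μ :=
      ((h.integrable.const_mul s).ofReal).mul_const _
    have i2 : Integrable (fun ω => ((s ^ 2 * X ω ^ 2 : ℝ) : ℂ) / 2) μ :=
      ((hint2.const_mul _).ofReal).div_const _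
    have i3 : Integrable (fun ω => (1 : ℂ) + ((s * X ω : ℝ) : ℂ) * Complex.I) μ :=
      (integrable_const _).add i1
    rw [integral_sub i3 i2, integral_add (integrable_const _) i1,
      integral_mul_const, integral_div, integral_complex_ofReal, integral_complex_ofReal,
      integral_const_mul, integral_const_mul, h0]
    simp
  have iT : Integrable (fun ω => 1 + ((s * X ω : ℝ) : ℂ) * Complex.I -
      ((s ^ 2 * X ω ^ 2 : ℝ) : ℂ) / 2) μ :=
    ((integrable_const _).add (((h.integrable.const_mul s).ofReal).mul_const _)).sub
      (((hint2.const_mul _).ofReal).div_const _)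
  rw [← hI, ← integral_sub hexp iT]
  refine (norm_integral_le_of_norm_le (((h.integrable_exp_mul 2).add
    (h.integrable_exp_mul (-2))).const_mul (6 * s ^ 3)) (Filter.Eventually.of_forall hp)).trans ?_
  simp only [Pi.add_apply]
  rw [integral_const_mul, integral_add (h.integrable_exp_mul 2) (h.integrable_exp_mul (-2))]
  have h1 := h.mgf_le 2
  have h2 := h.mgf_le (-2)
  simp only [mgf] at h1 h2
  have e1 : (c : ℝ) * 2 ^ 2 / 2 = 2 * c := by ring
  have e2 : (c : ℝ) * (-2) ^ 2 / 2 = 2 * c := by ring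
  rw [e1] at h1
  rw [e2] at h2
  calc _ ≤ 6 * s ^ 3 * (Real.exp (2 * c) + Real.exp (2 * c)) := by gcongr
    _ = _ := by ring

section CentralLimit

lemma tendsto_one_add_pow_exp_of_tendsto_mul {β : Type*} {l : Filter β} {N : β → ℕ} {w : β → ℂ}
    {t : ℂ} (h : Filter.Tendsto (fun k => N k * w k) l (nhds t))
    (hw : Filter.Tendsto w l (nhds 0)) :
    Filter.Tendsto (fun k => (1 + w k) ^ N k) l (nhds (Complex.exp t)) := by
  have h1 : Filter.Tendsto (fun k => 1 + w k) l (nhds 1) := by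
    simpa using hw.const_add 1
  have hd : HasDerivAt Complex.log 1 1 := by
    simpa using Complex.hasDerivAt_log Complex.one_mem_slitPlane
  have hc : ContinuousAt (dslope Complex.log 1) 1 := continuousAt_dslope_same.2 hd.differentiableAt
  have h2 : Filter.Tendsto (fun k => dslope Complex.log 1 (1 + w k)) l (nhds 1) := by
    have := hc.tendsto.comp h1
    rwa [dslope_same, hd.deriv] at this
  have h3 := (Complex.continuous_exp.tendsto _).comp (h.mul h2)
  rw [mul_one] at h3
  refine h3.congr' ?_
  filter_upwards [h1.eventually_ne one_ne_zero] with k hk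
  have e := sub_smul_dslope Complex.log 1 (1 + w k)
  rw [add_sub_cancel_left, Complex.log_one, sub_zero, smul_eq_mul] at e
  rw [Function.comp_apply, mul_assoc, e, Complex.exp_nat_mul, Complex.exp_log hk]

variable {ι α : Type*} [DecidableEq α] [Fintype ι]

/-- Isometries fixing the density fix the tilted measure. -/
lemma map_gaussTilt {F : EuclideanSpace ℝ ι → ℝ≥0∞} (hF : Measurable F)
    (f : EuclideanSpace ℝ ι ≃ₗᵢ[ℝ] EuclideanSpace ℝ ι) (hf : ∀ x, F (f x) = F x) :
    (gaussTilt F).map f = gaussTilt F := by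
  have hfm : Measurable f := f.continuous.measurable
  refine Measure.ext_of_lintegral _ fun G hG => ?_
  rw [lintegral_map hG hfm, lintegral_gaussTilt hF (G := fun x => G (f x)) (hG.comp hfm),
    lintegral_gaussTilt hF hG]
  congr 1
  have hm := stdGaussian_map f
  rw [← congrArg (fun μ => ∫⁻ x, F x * G x ∂μ) hm,
    lintegral_map (f := fun x => F x * G x) (hF.mul hG) hfm]
  simp [hf]

lemma integral_comp_gaussTilt {E : Type*} [NormedAddCommGroup E] [NormedSpace ℝ E]
    {F : EuclideanSpace ℝ ι → ℝ≥0∞} (hF : Measurable F)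
    (f : EuclideanSpace ℝ ι ≃ₗᵢ[ℝ] EuclideanSpace ℝ ι) (hf : ∀ x, F (f x) = F x)
    (g : EuclideanSpace ℝ ι → E) :
    ∫ x, g (f x) ∂(gaussTilt F) = ∫ x, g x ∂(gaussTilt F) := by
  conv_rhs => rw [← map_gaussTilt hF f hf]
  exact (f.toHomeomorph.measurableEmbedding.integral_map g).symm

/-- Change the sign of the coordinates in block `a`. -/
def blockFlip (b : ι → α) (a : α) : EuclideanSpace ℝ ι ≃ₗᵢ[ℝ] EuclideanSpace ℝ ι :=
  LinearIsometryEquiv.piLpCongrRight 2 fun i =>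
    if b i = a then LinearIsometryEquiv.neg ℝ else LinearIsometryEquiv.refl ℝ ℝ

lemma blockFlip_apply (b : ι → α) (a : α) (x : EuclideanSpace ℝ ι) (i : ι) :
    blockFlip b a x i = if b i = a then - x i else x i := by
  simp only [blockFlip, LinearIsometryEquiv.piLpCongrRight_apply]
  split_ifs <;> simp

variable {b : ι → α} {F : EuclideanSpace ℝ ι → ℝ≥0∞}

lemma IsBlockLogConcave.apply_blockFlip (hF : IsBlockLogConcave b F) (he : ∀ x, F (-x) = F x)
    (a : α) (x : EuclideanSpace ℝ ι) : F (blockFlip b a x) = F x := by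
  have h := hF.mul_eq a (-x) x
  have e1 : blockMix b a (-x) x = blockFlip b a x := by
    ext i; simp [blockFlip_apply]
  have e2 : blockMix b a x (-x) = - blockFlip b a x := by
    ext i; by_cases hi : b i = a <;> simp [blockFlip_apply, hi]
  rw [e1, e2, he, he, ← sq, ← sq] at h
  exact ((ENNReal.pow_right_strictMono two_ne_zero).injective h).symm

lemma IsBlockLogConcave.lintegral_mul_exp_le (hF : IsBlockLogConcave b F)
    (he : ∀ x, F (-x) = F x) (θ : EuclideanSpace ℝ ι) :
    ∫⁻ x, F x * ENNReal.ofReal (Real.exp ⟪θ, x⟫) ∂(stdGaussian (EuclideanSpace ℝ ι)) ≤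
      ENNReal.ofReal (Real.exp (‖θ‖ ^ 2 / 2)) * ∫⁻ x, F x ∂(stdGaussian (EuclideanSpace ℝ ι)) := by
  have hFm := hF.measurable
  have hsym : ∫⁻ x, F x * ENNReal.ofReal (Real.exp (-⟪θ, x⟫)) ∂(stdGaussian (EuclideanSpace ℝ ι)) =
      ∫⁻ x, F x * ENNReal.ofReal (Real.exp ⟪θ, x⟫) ∂(stdGaussian (EuclideanSpace ℝ ι)) := by
    have hm := stdGaussian_map (LinearIsometryEquiv.neg ℝ (E := EuclideanSpace ℝ ι))
    have := congrArg (fun μ => ∫⁻ x, F x * ENNReal.ofReal (Real.exp ⟪θ, x⟫) ∂μ) hm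
    simp only at this
    rw [← this, lintegral_map (by fun_prop) (by fun_prop)]
    simp [he]
  have key := lintegral_stdGaussian_mul_le_sq
    (f := fun x => F x * ENNReal.ofReal (Real.exp ⟪θ, x⟫))
    (g := fun x => F x * ENNReal.ofReal (Real.exp (-⟪θ, x⟫)))
    (h := fun x => ENNReal.ofReal (Real.exp (‖θ‖ ^ 2 / 2)) * F x)
    (by fun_prop) (by fun_prop) (by fun_prop) (fun x y => by
      rw [mul_mul_mul_comm, mul_pow, mul_comm (_ ^ 2 : ℝ≥0∞) (_ ^ 2), mul_assoc (_ ^ 2 : ℝ≥0∞)]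
      refine mul_le_mul' (hF.mul_le_sq x y) ?_
      rw [← ENNReal.ofReal_pow (by positivity), ← ENNReal.ofReal_mul (by positivity),
        ← ENNReal.ofReal_mul (by positivity)]
      refine ENNReal.ofReal_le_ofReal ?_
      rw [← Real.exp_nat_mul, ← Real.exp_add, ← Real.exp_add, Real.exp_le_exp]
      have h1 : ⟪θ, x⟫ + -⟪θ, y⟫ = ⟪θ, x - y⟫ := by rw [inner_sub_right]; ring
      have h2 := real_inner_le_norm θ (x - y)
      rw [h1]
      push_cast
      nlinarith [sq_nonneg (‖θ‖ - ‖x - y‖ / 2)])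
  rw [hsym, ← sq, lintegral_const_mul _ hFm] at key
  exact (ENNReal.pow_right_strictMono two_ne_zero).le_iff_le.1 key

lemma IsBlockLogConcave.hasSubgaussianMGF_inner (hF : IsBlockLogConcave b F)
    (he : ∀ x, F (-x) = F x) (h0 : ∫⁻ x, F x ∂(stdGaussian (EuclideanSpace ℝ ι)) ≠ 0)
    (θ : EuclideanSpace ℝ ι) :
    HasSubgaussianMGF (fun x => ⟪θ, x⟫) (‖θ‖₊ ^ 2) (gaussTilt F) := by
  have htop := ne_top_of_le_ne_top (by simp) hF.lintegral_le_one
  have key : ∀ t : ℝ, ∫⁻ x, ENNReal.ofReal (Real.exp (t * ⟪θ, x⟫)) ∂(gaussTilt F) ≤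
      ENNReal.ofReal (Real.exp ((‖θ‖₊ ^ 2 : NNReal) * t ^ 2 / 2)) := by
    intro t
    rw [lintegral_gaussTilt hF.measurable (by fun_prop)]
    have h1 := hF.lintegral_mul_exp_le he (t • θ)
    simp only [real_inner_smul_left, norm_smul, Real.norm_eq_abs, mul_pow, sq_abs] at h1
    refine (mul_le_mul' le_rfl h1).trans (le_of_eq ?_)
    rw [mul_left_comm, ENNReal.inv_mul_cancel h0 htop, mul_one]
    congr 3
    push_cast
    ring
  constructor
  · intro t
    refine ⟨by fun_prop, ?_⟩
    rw [hasFiniteIntegral_iff_ofReal (Filter.Eventually.of_forall fun x => (Real.exp_pos _).le)]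
    exact (key t).trans_lt ENNReal.ofReal_lt_top
  · intro t
    rw [mgf, integral_eq_lintegral_of_nonneg_ae
      (Filter.Eventually.of_forall fun x => (Real.exp_pos _).le) (by fun_prop)]
    exact ENNReal.toReal_le_of_le_ofReal (Real.exp_pos _).le (key t)

lemma integral_inner_gaussTilt_eq_zero (hF : Measurable F) (he : ∀ x, F (-x) = F x)
    (θ : EuclideanSpace ℝ ι) : ∫ x, ⟪θ, x⟫ ∂(gaussTilt F) = 0 := by
  have := integral_comp_gaussTilt hF (LinearIsometryEquiv.neg ℝ) (by simpa using he)
    (fun x => ⟪θ, x⟫)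
  simp only [LinearIsometryEquiv.coe_neg, inner_neg_right, integral_neg] at this
  linarith

/-- The matrix of second moments of a measure. -/
def secondMoment (ν : Measure (EuclideanSpace ℝ ι)) : Matrix ι ι ℝ :=
  Matrix.of fun i j => ∫ x, x i * x j ∂ν

lemma secondMoment_gaussTilt_eq_zero (hF : IsBlockLogConcave b F) (he : ∀ x, F (-x) = F x)
    {i j : ι} (hij : b i ≠ b j) : secondMoment (gaussTilt F) i j = 0 := by
  have := integral_comp_gaussTilt hF.measurable (blockFlip b (b i))
    (hF.apply_blockFlip he (b i)) (fun x => x i * x j)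
  simp only [blockFlip_apply, if_true, if_neg hij.symm, neg_mul, integral_neg] at this
  simp only [secondMoment, Matrix.of_apply]
  linarith

lemma dotProduct_secondMoment_mulVec {ν : Measure (EuclideanSpace ℝ ι)}
    (h : ∀ i j, Integrable (fun x : EuclideanSpace ℝ ι => x i * x j) ν)
    (θ : EuclideanSpace ℝ ι) :
    θ ⬝ᵥ secondMoment ν *ᵥ θ = ∫ x, ⟪θ, x⟫ ^ 2 ∂ν := by
  have e : ∀ x : EuclideanSpace ℝ ι, ⟪θ, x⟫ ^ 2 = ∑ i, ∑ j, θ i * θ j * (x i * x j) := by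
    intro x
    rw [PiLp.inner_apply, sq, Finset.sum_mul_sum]
    refine Finset.sum_congr rfl fun i _ => Finset.sum_congr rfl fun j _ => ?_
    simp
    ring
  simp only [e]
  rw [integral_finsetSum _ fun i _ => integrable_finsetSum _ fun j _ => (h i j).const_mul _]
  simp only [dotProduct, mulVec, Finset.mul_sum]
  refine Finset.sum_congr rfl fun i _ => ?_
  rw [integral_finsetSum _ fun j _ => (h i j).const_mul _]
  refine Finset.sum_congr rfl fun j _ => ?_
  rw [integral_const_mul]
  simp only [secondMoment, Matrix.of_apply]
  ring

lemma IsBlockLogConcave.integrable_mul (hF : IsBlockLogConcave b F) (he : ∀ x, F (-x) = F x)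
    (h0 : ∫⁻ x, F x ∂(stdGaussian (EuclideanSpace ℝ ι)) ≠ 0) (i j : ι) :
    Integrable (fun x : EuclideanSpace ℝ ι => x i * x j) (gaussTilt F) := by
  classical
  have h : ∀ i, MemLp (fun x : EuclideanSpace ℝ ι => x i) 2 (gaussTilt F) := fun i => by
    simpa [EuclideanSpace.inner_single_left] using
      (hF.hasSubgaussianMGF_inner he h0 (EuclideanSpace.single i 1)).memLp 2
  exact (h i).integrable_mul (h j)

lemma IsBlockLogConcave.dotProduct_secondMoment_le (hF : IsBlockLogConcave b F)
    (he : ∀ x, F (-x) = F x) (h0 : ∫⁻ x, F x ∂(stdGaussian (EuclideanSpace ℝ ι)) ≠ 0)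
    (θ : EuclideanSpace ℝ ι) :
    θ ⬝ᵥ secondMoment (gaussTilt F) *ᵥ θ ≤ ‖θ‖ ^ 2 := by
  have := hF.isProbabilityMeasure h0
  rw [dotProduct_secondMoment_mulVec (hF.integrable_mul he h0)]
  simpa using integral_sq_le_of_hasSubgaussianMGF (hF.hasSubgaussianMGF_inner he h0 θ)

lemma IsBlockLogConcave.abs_secondMoment_le (hF : IsBlockLogConcave b F)
    (he : ∀ x, F (-x) = F x) (h0 : ∫⁻ x, F x ∂(stdGaussian (EuclideanSpace ℝ ι)) ≠ 0)
    (i j : ι) : |secondMoment (gaussTilt F) i j| ≤ 1 := by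
  classical
  have := hF.isProbabilityMeasure h0
  have h : ∀ i, ∫ x : EuclideanSpace ℝ ι, x i ^ 2 ∂(gaussTilt F) ≤ 1 := fun i => by
    simpa [EuclideanSpace.inner_single_left] using integral_sq_le_of_hasSubgaussianMGF
      (hF.hasSubgaussianMGF_inner he h0 (EuclideanSpace.single i 1))
  have hi : ∀ i, Integrable (fun x : EuclideanSpace ℝ ι => x i ^ 2) (gaussTilt F) := fun i => by
    simpa [sq] using hF.integrable_mul he h0 i i
  simp only [secondMoment, Matrix.of_apply]
  refine (abs_integral_le_integral_abs).trans ?_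
  calc ∫ x : EuclideanSpace ℝ ι, |x i * x j| ∂(gaussTilt F)
      ≤ ∫ x : EuclideanSpace ℝ ι, (x i ^ 2 + x j ^ 2) / 2 ∂(gaussTilt F) := by
        refine integral_mono (hF.integrable_mul he h0 i j).abs (((hi i).add (hi j)).div_const 2)
          fun x => ?_
        simp only [abs_mul]
        nlinarith [sq_nonneg (|x i| - |x j|), sq_abs (x i), sq_abs (x j)]
    _ ≤ 1 := by
        rw [integral_div, integral_add (hi i) (hi j)]
        linarith [h i, h j]

lemma IsBlockLogConcave.iterate_double (hF : IsBlockLogConcave b F) (n : ℕ) :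
    IsBlockLogConcave b (_root_.double^[n] F) := by
  induction n with
  | zero => exact hF
  | succ n ih => rw [Function.iterate_succ_apply']; exact ih.double

lemma lintegral_iterate_double (hF : IsBlockLogConcave b F) (n : ℕ) :
    ∫⁻ u, double^[n] F u ∂(stdGaussian (EuclideanSpace ℝ ι)) =
      (∫⁻ x, F x ∂(stdGaussian (EuclideanSpace ℝ ι))) ^ 2 ^ n := by
  induction n with
  | zero => simp
  | succ n ih =>
    rw [Function.iterate_succ_apply', lintegral_double (hF.iterate_double n).measurable, ih,
      ← pow_mul, pow_succ]

lemma charFun_gaussTilt_iterate_double (hF : IsBlockLogConcave b F)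
    (h0 : ∫⁻ x, F x ∂(stdGaussian (EuclideanSpace ℝ ι)) ≠ 0) (n : ℕ) (ξ : EuclideanSpace ℝ ι) :
    charFun (gaussTilt (double^[n] F)) ξ =
      charFun (gaussTilt F) (((√2)⁻¹) ^ n • ξ) ^ 2 ^ n := by
  induction n generalizing ξ with
  | zero => simp
  | succ n ih =>
    have h1 : ∫⁻ x, double^[n] F x ∂(stdGaussian (EuclideanSpace ℝ ι)) ≠ 0 := by
      rw [lintegral_iterate_double hF]; exact pow_ne_zero _ h0
    have := (hF.iterate_double n).isProbabilityMeasure h1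
    rw [Function.iterate_succ_apply', gaussTilt_double (hF.iterate_double n) h1,
      charFun_map_smul, charFun_conv, ih, smul_smul, ← pow_succ, ← mul_pow, ← sq, ← pow_mul,
      ← pow_succ']

end CentralLimit

section GaussTilt

variable {ι α : Type*} [DecidableEq α] [Fintype ι]
variable {b : ι → α}

lemma charFun_gaussTilt_sub_le {F : EuclideanSpace ℝ ι → ℝ≥0∞} (hF : IsBlockLogConcave b F)
    (he : ∀ x, F (-x) = F x) (h0 : ∫⁻ x, F x ∂(stdGaussian (EuclideanSpace ℝ ι)) ≠ 0)
    (ξ : EuclideanSpace ℝ ι) {s : ℝ} (hs0 : 0 ≤ s) (hs1 : s ≤ 1) :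
    ‖charFun (gaussTilt F) (s • ξ) -
      (1 - ((s ^ 2 * (ξ ⬝ᵥ secondMoment (gaussTilt F) *ᵥ ξ) : ℝ) : ℂ) / 2)‖ ≤
      12 * Real.exp (2 * ‖ξ‖ ^ 2) * s ^ 3 := by
  have := hF.isProbabilityMeasure h0
  have h := norm_charFun_sub_le_of_hasSubgaussianMGF (hF.hasSubgaussianMGF_inner he h0 ξ)
    (integral_inner_gaussTilt_eq_zero hF.measurable he ξ) hs0 hs1
  rw [dotProduct_secondMoment_mulVec (hF.integrable_mul he h0), charFun_apply]
  simp only [real_inner_smul_right, real_inner_comm ξ]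
  simpa using h

lemma tendsto_charFun_gaussTilt_iterate_double {F : ℕ → EuclideanSpace ℝ ι → ℝ≥0∞}
    (hF : ∀ n, IsBlockLogConcave b (F n)) (he : ∀ n x, F n (-x) = F n x)
    (h0 : ∀ n, ∫⁻ x, F n x ∂(stdGaussian (EuclideanSpace ℝ ι)) ≠ 0)
    {A : Matrix ι ι ℝ} {φ : ℕ → ℕ} (hφ : StrictMono φ)
    (hA : Filter.Tendsto (fun n => secondMoment (gaussTilt (F (φ n)))) Filter.atTop (nhds A))
    (ξ : EuclideanSpace ℝ ι) :
    Filter.Tendsto (fun n => charFun (gaussTilt (double^[φ n] (F (φ n)))) ξ) Filter.atTop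
      (nhds (Complex.exp (-((ξ ⬝ᵥ A *ᵥ ξ : ℝ) : ℂ) / 2))) := by
  simp only [charFun_gaussTilt_iterate_double (hF _) (h0 _)]
  set s : ℕ → ℝ := fun n => ((√2)⁻¹) ^ φ n with hs
  set q : ℕ → ℝ := fun n => ξ ⬝ᵥ secondMoment (gaussTilt (F (φ n))) *ᵥ ξ with hq
  have hr1 : (√2)⁻¹ < 1 := inv_lt_one_of_one_lt₀ (by
    rw [Real.lt_sqrt] <;> norm_num)
  have hs0 : ∀ n, 0 ≤ s n := fun n => by positivity
  have hs1 : ∀ n, s n ≤ 1 := fun n => pow_le_one₀ (by positivity) hr1.le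
  have hsN : ∀ n, ((2 ^ φ n : ℕ) : ℝ) * s n ^ 2 = 1 := fun n => by
    simp only [hs]
    rw [← pow_mul, mul_comm (φ n) 2, pow_mul, inv_pow, Real.sq_sqrt (by norm_num)]
    push_cast
    rw [← mul_pow]
    norm_num
  have hst : Filter.Tendsto s Filter.atTop (nhds 0) :=
    (tendsto_pow_atTop_nhds_zero_of_lt_one (by positivity) hr1).comp hφ.tendsto_atTop
  have hqt : Filter.Tendsto q Filter.atTop (nhds (ξ ⬝ᵥ A *ᵥ ξ)) := by
    have hc : Continuous fun M : Matrix ι ι ℝ => (ξ : ι → ℝ) ⬝ᵥ M *ᵥ ξ :=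
      Continuous.dotProduct continuous_const (continuous_id.matrix_mulVec continuous_const)
    exact (hc.tendsto A).comp hA
  set w : ℕ → ℂ := fun n => charFun (gaussTilt (F (φ n))) (s n • ξ) - 1 with hw
  have hwb : ∀ n, ‖w n + ((s n ^ 2 * q n : ℝ) : ℂ) / 2‖ ≤
      12 * Real.exp (2 * ‖ξ‖ ^ 2) * s n ^ 3 := by
    intro n
    have := charFun_gaussTilt_sub_le (hF (φ n)) (he (φ n)) (h0 (φ n)) ξ (hs0 n) (hs1 n)
    convert this using 2
    simp only [hw, hq]
    ring
  have hNw : Filter.Tendsto (fun n => ((2 ^ φ n : ℕ) : ℂ) * w n) Filter.atTop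
      (nhds (-((ξ ⬝ᵥ A *ᵥ ξ : ℝ) : ℂ) / 2)) := by
    have h1 : Filter.Tendsto (fun n => ((2 ^ φ n : ℕ) : ℂ) * w n + ((q n : ℝ) : ℂ) / 2)
        Filter.atTop (nhds 0) := by
      refine squeeze_zero_norm (a := fun n => 12 * Real.exp (2 * ‖ξ‖ ^ 2) * s n) (fun n => ?_)
        (by simpa using hst.const_mul (12 * Real.exp (2 * ‖ξ‖ ^ 2)))
      have e : ((2 ^ φ n : ℕ) : ℂ) * w n + ((q n : ℝ) : ℂ) / 2 =
          ((2 ^ φ n : ℕ) : ℂ) * (w n + ((s n ^ 2 * q n : ℝ) : ℂ) / 2) := by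
        have : ((2 ^ φ n : ℕ) : ℂ) * (s n : ℂ) ^ 2 = 1 := by exact_mod_cast hsN n
        rw [Complex.ofReal_mul, Complex.ofReal_pow]
        linear_combination (-(q n : ℂ) / 2) * this
      rw [e, norm_mul, Complex.norm_natCast]
      calc _ ≤ ((2 ^ φ n : ℕ) : ℝ) * (12 * Real.exp (2 * ‖ξ‖ ^ 2) * s n ^ 3) := by
            gcongr; exact hwb n
        _ = 12 * Real.exp (2 * ‖ξ‖ ^ 2) * s n * (((2 ^ φ n : ℕ) : ℝ) * s n ^ 2) := by ring
        _ = _ := by rw [hsN, mul_one]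
    have h2 : Filter.Tendsto (fun n => ((q n : ℝ) : ℂ) / 2) Filter.atTop
        (nhds (((ξ ⬝ᵥ A *ᵥ ξ : ℝ) : ℂ) / 2)) :=
      ((Complex.continuous_ofReal.tendsto _).comp hqt).div_const 2
    have h3 := h1.sub h2
    simp only [add_sub_cancel_right, zero_sub] at h3
    rwa [neg_div]
  have hw0 : Filter.Tendsto w Filter.atTop (nhds 0) := by
    have h1 : Filter.Tendsto (fun n => ((s n : ℝ) : ℂ) ^ 2) Filter.atTop (nhds 0) := by
      have := ((Complex.continuous_ofReal.tendsto _).comp hst).pow 2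
      simpa using this
    have h2 := h1.mul hNw
    rw [zero_mul] at h2
    refine h2.congr fun n => ?_
    have : ((2 ^ φ n : ℕ) : ℂ) * (s n : ℂ) ^ 2 = 1 := by exact_mod_cast hsN n
    linear_combination w n * this
  have := tendsto_one_add_pow_exp_of_tendsto_mul hNw hw0
  simpa only [hw, add_sub_cancel] using this

/-- Subsequential central limit theorem for tilted measures of iterated doublings. -/
lemma exists_tendsto_charFun_gaussTilt [DecidableEq ι] {F : ℕ → EuclideanSpace ℝ ι → ℝ≥0∞}
    (hF : ∀ n, IsBlockLogConcave b (F n)) (he : ∀ n x, F n (-x) = F n x)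
    (h0 : ∀ n, ∫⁻ x, F n x ∂(stdGaussian (EuclideanSpace ℝ ι)) ≠ 0) :
    ∃ (A : Matrix ι ι ℝ) (φ : ℕ → ℕ), StrictMono φ ∧ A.PosSemidef ∧ (1 - A).PosSemidef ∧
      (∀ i j, b i ≠ b j → A i j = 0) ∧
      ∀ ξ, Filter.Tendsto (fun n => charFun (gaussTilt (double^[φ n] (F (φ n)))) ξ) Filter.atTop
        (nhds (charFun (multivariateGaussian 0 A) ξ)) := by
  obtain ⟨A, φ, hφ, hA⟩ : ∃ (A : Matrix ι ι ℝ) (φ : ℕ → ℕ), StrictMono φ ∧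
      Filter.Tendsto (fun n => secondMoment (gaussTilt (F (φ n)))) Filter.atTop (nhds A) := by
    have hcpt : IsCompact (Set.pi Set.univ fun _ : ι => Set.pi Set.univ fun _ : ι =>
        Set.Icc (-1 : ℝ) 1) :=
      isCompact_univ_pi fun _ => isCompact_univ_pi fun _ => isCompact_Icc
    obtain ⟨A, -, φ, hφ, hA⟩ := hcpt.tendsto_subseq
      (x := fun n i j => secondMoment (gaussTilt (F n)) i j) (fun n i _ j _ =>
        abs_le.1 ((hF n).abs_secondMoment_le (he n) (h0 n) i j))
    exact ⟨A, φ, hφ, hA⟩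
  have hent : ∀ i j, Filter.Tendsto (fun n => secondMoment (gaussTilt (F (φ n))) i j)
      Filter.atTop (nhds (A i j)) := fun i j => tendsto_pi_nhds.1 (tendsto_pi_nhds.1 hA i) j
  have hquad : ∀ x : ι → ℝ, Filter.Tendsto
      (fun n => x ⬝ᵥ secondMoment (gaussTilt (F (φ n))) *ᵥ x) Filter.atTop
      (nhds (x ⬝ᵥ A *ᵥ x)) := by
    intro x
    have hc : Continuous fun M : Matrix ι ι ℝ => x ⬝ᵥ M *ᵥ x :=
      Continuous.dotProduct continuous_const (continuous_id.matrix_mulVec continuous_const)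
    exact (hc.tendsto _).comp hA
  have hsymm : A.IsHermitian := by
    ext i j
    refine tendsto_nhds_unique ((hent j i).congr fun n => ?_) (hent i j)
    simp only [secondMoment, Matrix.of_apply, mul_comm]
  have hpsd : A.PosSemidef := by
    refine Matrix.PosSemidef.of_dotProduct_mulVec_nonneg hsymm fun x => ?_
    rw [star_trivial]
    refine ge_of_tendsto (hquad x) (Filter.Eventually.of_forall fun n => ?_)
    have := dotProduct_secondMoment_mulVec ((hF (φ n)).integrable_mul (he (φ n)) (h0 (φ n)))
      (WithLp.toLp 2 x)
    simp only at this
    rw [this]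
    positivity
  refine ⟨A, φ, hφ, hpsd, ?_, ?_, ?_⟩
  · refine Matrix.PosSemidef.of_dotProduct_mulVec_nonneg (Matrix.isHermitian_one.sub hsymm)
      fun x => ?_
    rw [star_trivial, sub_mulVec, one_mulVec, dotProduct_sub, sub_nonneg]
    refine le_of_tendsto (hquad x) (Filter.Eventually.of_forall fun n => ?_)
    have := (hF (φ n)).dotProduct_secondMoment_le (he (φ n)) (h0 (φ n)) (WithLp.toLp 2 x)
    rw [EuclideanSpace.real_norm_sq_eq] at this
    simpa [dotProduct, sq] using this
  · intro i j hij
    refine tendsto_nhds_unique (hent i j) ?_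
    simp [secondMoment_gaussTilt_eq_zero (hF _) (he _) hij]
  · intro ξ
    convert tendsto_charFun_gaussTilt_iterate_double hF he h0 hφ hA ξ using 2
    rw [charFun_multivariateGaussian hpsd]
    simp [neg_div]

lemma lintegral_le_liminf_of_tendsto_charFun {E : Type*} [NormedAddCommGroup E]
    [InnerProductSpace ℝ E] [FiniteDimensional ℝ E] [MeasurableSpace E] [BorelSpace E]
    {ν : ℕ → Measure E} {ν₀ : Measure E} [∀ n, IsProbabilityMeasure (ν n)]
    [IsProbabilityMeasure ν₀]
    (h : ∀ ξ, Filter.Tendsto (fun n => charFun (ν n) ξ) Filter.atTop (nhds (charFun ν₀ ξ)))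
    {K : E → ℝ} (hK : Continuous K) (hK0 : 0 ≤ K) :
    ∫⁻ x, ENNReal.ofReal (K x) ∂ν₀ ≤
      Filter.liminf (fun n => ∫⁻ x, ENNReal.ofReal (K x) ∂(ν n)) Filter.atTop := by
  let νp : ℕ → ProbabilityMeasure E := fun n => ⟨ν n, inferInstance⟩
  let ν₀p : ProbabilityMeasure E := ⟨ν₀, inferInstance⟩
  have ht : Filter.Tendsto νp Filter.atTop (nhds ν₀p) :=
    ProbabilityMeasure.tendsto_of_tendsto_charFun h
  refine lintegral_le_liminf_lintegral_of_forall_isOpen_measure_le_liminf_measure hK hK0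
    fun G hG => ?_
  exact ProbabilityMeasure.le_liminf_measure_open_of_tendsto ht hG

end GaussTilt

section Density

variable {ι : Type*} [Fintype ι]

lemma stdGaussian_eq_smul_withDensity :
    stdGaussian (EuclideanSpace ℝ ι) =
      ENNReal.ofReal (((2 * Real.pi) ^ (Fintype.card ι / 2 : ℝ))⁻¹) •
        (volume : Measure (EuclideanSpace ℝ ι)).withDensity
          fun x => ENNReal.ofReal (Real.exp (-(x ⬝ᵥ x) / 2)) := by
  have hnorm : ∀ x : EuclideanSpace ℝ ι, (x : ι → ℝ) ⬝ᵥ x = ‖x‖ ^ 2 := fun x => by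
    rw [EuclideanSpace.real_norm_sq_eq]; simp [dotProduct, sq]
  have hfin : IsFiniteMeasure ((volume : Measure (EuclideanSpace ℝ ι)).withDensity
      fun x => ENNReal.ofReal (Real.exp (-(x ⬝ᵥ x) / 2))) := by
    refine isFiniteMeasure_withDensity_ofReal ?_
    have := (GaussianFourier.integrable_cexp_neg_mul_sq_norm_add (V := EuclideanSpace ℝ ι)
      (b := 1 / 2) (by norm_num) 0 0).norm
    refine (this.congr (Filter.Eventually.of_forall fun x => ?_)).2
    simp only [Complex.norm_exp, hnorm]
    congr 1
    have e : (-(1 / 2 : ℂ) * (‖x‖ : ℂ) ^ 2 + 0 * ((⟪0, x⟫ : ℝ) : ℂ)) =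
        ((-‖x‖ ^ 2 / 2 : ℝ) : ℂ) := by
      push_cast
      ring
    rw [e, Complex.ofReal_re]
  have hfin' := (volume.withDensity
      fun x : EuclideanSpace ℝ ι => ENNReal.ofReal (Real.exp (-(x ⬝ᵥ x) / 2))).smul_finite
      (c := ENNReal.ofReal (((2 * Real.pi) ^ (Fintype.card ι / 2 : ℝ))⁻¹)) ENNReal.ofReal_ne_top
  refine Measure.ext_of_charFun (funext fun t => ?_)
  have hpi : (0 : ℝ) < (2 * Real.pi) ^ (Fintype.card ι / 2 : ℝ) := by positivity
  rw [charFun_stdGaussian, charFun_apply, integral_smul_measure,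
    integral_withDensity_eq_integral_toReal_smul (by fun_prop)
      (Filter.Eventually.of_forall fun _ => ENNReal.ofReal_lt_top)]
  have h := GaussianFourier.integral_cexp_neg_mul_sq_norm_add (b := 1 / 2) (by norm_num)
    Complex.I t
  have e : ∀ x : EuclideanSpace ℝ ι, (ENNReal.ofReal (Real.exp (-(x ⬝ᵥ x) / 2))).toReal •
      Complex.exp (⟪x, t⟫ * Complex.I) =
      Complex.exp (-(1 / 2) * ‖x‖ ^ 2 + Complex.I * ⟪t, x⟫) := by
    intro x
    rw [ENNReal.toReal_ofReal (Real.exp_pos _).le, Complex.real_smul, Complex.ofReal_exp,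
      ← Complex.exp_add, hnorm, real_inner_comm]
    congr 1
    push_cast
    ring
  simp only [e]
  rw [h, ENNReal.toReal_ofReal (by positivity), finrank_euclideanSpace]
  have e2 : (Real.pi / (1 / 2 : ℂ)) ^ ((Fintype.card ι : ℂ) / 2) =
      (((2 * Real.pi) ^ (Fintype.card ι / 2 : ℝ) : ℝ) : ℂ) := by
    rw [Complex.ofReal_cpow (by positivity)]
    congr 1
    · push_cast; ring
    · push_cast; ring
  rw [e2, Complex.real_smul, ← mul_assoc, ← Complex.ofReal_mul, inv_mul_cancel₀ hpi.ne',
    Complex.ofReal_one, one_mul]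
  congr 1
  rw [Complex.I_sq]
  ring

lemma lintegral_stdGaussian {F : EuclideanSpace ℝ ι → ℝ≥0∞} (hF : Measurable F) :
    ∫⁻ x, F x ∂(stdGaussian (EuclideanSpace ℝ ι)) =
      ENNReal.ofReal (((2 * Real.pi) ^ (Fintype.card ι / 2 : ℝ))⁻¹) *
        ∫⁻ x : EuclideanSpace ℝ ι, ENNReal.ofReal (Real.exp (-(x ⬝ᵥ x) / 2)) * F x := by
  rw [stdGaussian_eq_smul_withDensity, lintegral_smul_measure,
    lintegral_withDensity_eq_lintegral_mul _ (by fun_prop) hF]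
  rfl

variable [DecidableEq ι]

lemma lintegral_comp_toEuclideanCLM {M : Matrix ι ι ℝ} (hM : M.det ≠ 0)
    {G : EuclideanSpace ℝ ι → ℝ≥0∞} (hG : Measurable G) :
    ∫⁻ x, G (toEuclideanCLM (𝕜 := ℝ) M x) = ENNReal.ofReal |M.det⁻¹| * ∫⁻ x, G x := by
  have hd : LinearMap.det (M.toLpLin 2 2) = M.det := LinearMap.det_toLpLin 2 M
  have h := Measure.map_linearMap_addHaar_eq_smul_addHaar
    (volume : Measure (EuclideanSpace ℝ ι)) (f := M.toLpLin 2 2) (by rw [hd]; exact hM)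
  have hm : Measurable (M.toLpLin 2 2) := (toEuclideanCLM (𝕜 := ℝ) M).measurable
  have h2 := congrArg (fun μ => ∫⁻ x, G x ∂μ) h
  simp only [lintegral_map hG hm, lintegral_smul_measure, hd] at h2
  exact h2

/-- The density of the centered Gaussian measure of covariance `S` relative to the standard one. -/
def gaussRatio (S : Matrix ι ι ℝ) (y : EuclideanSpace ℝ ι) : ℝ :=
  (√S.det)⁻¹ * Real.exp ((y ⬝ᵥ y - y ⬝ᵥ S⁻¹ *ᵥ y) / 2)

lemma continuous_gaussRatio (S : Matrix ι ι ℝ) : Continuous (gaussRatio S) := by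
  unfold gaussRatio
  have h : Continuous fun y : EuclideanSpace ℝ ι => (y : ι → ℝ) := by fun_prop
  exact continuous_const.mul (Real.continuous_exp.comp
    (((h.dotProduct h).sub (h.dotProduct (continuous_const.matrix_mulVec h))).div_const 2))

open scoped MatrixOrder in
lemma lintegral_multivariateGaussian {S : Matrix ι ι ℝ} (hS : S.PosDef)
    {F : EuclideanSpace ℝ ι → ℝ≥0∞} (hF : Measurable F) :
    ∫⁻ x, F x ∂(multivariateGaussian 0 S) =
      ∫⁻ x, ENNReal.ofReal (gaussRatio S x) * F x ∂(stdGaussian (EuclideanSpace ℝ ι)) := by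
  have hcont := continuous_gaussRatio S
  set T := CFC.sqrt S with hT
  have hTT : T * T = S := CFC.sqrt_mul_sqrt_self _ hS.posSemidef.nonneg
  have hTdet : T.det = √S.det := by
    rw [hT, hS.posSemidef.det_sqrt, RCLike.sqrt_of_nonneg hS.det_pos.le]; rfl
  have hpos : 0 < √S.det := Real.sqrt_pos.2 hS.det_pos
  have hsymm : Tᵀ = T := by
    have := (CFC.sqrt_nonneg S).posSemidef.isHermitian
    rwa [IsHermitian, conjTranspose_eq_transpose_of_trivial] at this
  have hunit : IsUnit T.det := by rw [hTdet]; exact hpos.ne'.isUnit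
  have hTST : T * S⁻¹ * T = 1 := by
    rw [← hTT, Matrix.mul_inv_rev, ← mul_assoc, Matrix.mul_nonsing_inv _ hunit, one_mul,
      Matrix.nonsing_inv_mul _ hunit]
  rw [multivariateGaussian, ← hT, lintegral_map hF (by fun_prop),
    lintegral_stdGaussian (by fun_prop),
    lintegral_stdGaussian (by fun_prop)]
  congr 1
  have e : ∀ x : EuclideanSpace ℝ ι,
      ENNReal.ofReal (Real.exp (-(x ⬝ᵥ x) / 2)) * F (0 + toEuclideanCLM (𝕜 := ℝ) T x) =
      (fun y : EuclideanSpace ℝ ι => ENNReal.ofReal (Real.exp (-(y ⬝ᵥ S⁻¹ *ᵥ y) / 2)) * F y)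
        (toEuclideanCLM (𝕜 := ℝ) T x) := by
    intro x
    simp only [zero_add, ofLp_toEuclideanCLM]
    congr 5
    have hsw : ∀ w, (T *ᵥ x.ofLp) ⬝ᵥ w = x.ofLp ⬝ᵥ T *ᵥ w := fun w => by
      rw [dotProduct_mulVec, ← mulVec_transpose, hsymm]
    rw [hsw, mulVec_mulVec, mulVec_mulVec, hTST, one_mulVec]
  have hq : Continuous fun y : EuclideanSpace ℝ ι => (y : ι → ℝ) ⬝ᵥ S⁻¹ *ᵥ y := by
    have h : Continuous fun y : EuclideanSpace ℝ ι => (y : ι → ℝ) := by fun_prop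
    exact h.dotProduct (continuous_const.matrix_mulVec h)
  simp only [e]
  rw [lintegral_comp_toEuclideanCLM (by rw [hTdet]; exact hpos.ne')
    (G := fun y : EuclideanSpace ℝ ι => ENNReal.ofReal (Real.exp (-(y ⬝ᵥ S⁻¹ *ᵥ y) / 2)) * F y)
    (by fun_prop), ← lintegral_const_mul _ (by fun_prop), hTdet]
  refine lintegral_congr fun y => ?_
  rw [← mul_assoc, ← mul_assoc, ← ENNReal.ofReal_mul (by positivity),
    ← ENNReal.ofReal_mul (by positivity), abs_of_pos (by positivity), gaussRatio, mul_left_comm,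
    ← Real.exp_add]
  congr 4
  ring

lemma lintegral_exp_quadratic {M : Matrix ι ι ℝ} (hM : M.PosDef) :
    ∫⁻ x, ENNReal.ofReal (Real.exp ((x ⬝ᵥ x - x ⬝ᵥ M *ᵥ x) / 2))
      ∂(stdGaussian (EuclideanSpace ℝ ι)) = ENNReal.ofReal (√M.det)⁻¹ := by
  have h := lintegral_multivariateGaussian hM.inv (F := fun _ => 1) measurable_const
  have hunit : IsUnit M.det := hM.det_pos.ne'.isUnit
  have hpos : 0 < √M.det := Real.sqrt_pos.2 hM.det_pos
  simp only [gaussRatio, Matrix.nonsing_inv_nonsing_inv _ hunit, lintegral_const, measure_univ,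
    mul_one, Matrix.det_nonsing_inv, Ring.inverse_eq_inv', Real.sqrt_inv, inv_inv,
    ENNReal.ofReal_mul hpos.le] at h
  rw [lintegral_const_mul' _ _ ENNReal.ofReal_ne_top] at h
  rw [ENNReal.ofReal_inv_of_pos hpos]
  exact ENNReal.eq_inv_of_mul_eq_one_left (by rw [mul_comm]; exact h.symm)

end Density

section GaussianCase

variable {ι : Type*} [Fintype ι] [DecidableEq ι]

lemma Matrix.PosSemidef.det_le_exp_trace_sub {M : Matrix ι ι ℝ} (hM : M.PosSemidef) :
    M.det ≤ Real.exp ((M - 1).trace) := by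
  rw [hM.isHermitian.det_eq_prod_eigenvalues, trace_sub, hM.isHermitian.trace_eq_sum_eigenvalues,
    trace_one]
  simp only [RCLike.ofReal_real_eq_id, id_eq]
  have e : ∑ i, hM.isHermitian.eigenvalues i - (Fintype.card ι : ℝ) =
      ∑ i, (hM.isHermitian.eigenvalues i - 1) := by simp
  rw [e, Real.exp_sum]
  refine Finset.prod_le_prod (fun i _ => hM.eigenvalues_nonneg i) fun i _ => ?_
  have := Real.add_one_le_exp (hM.isHermitian.eigenvalues i - 1)
  linarith

open scoped MatrixOrder

lemma transpose_sqrt (A : Matrix ι ι ℝ) : (CFC.sqrt A)ᵀ = CFC.sqrt A := by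
  have := (CFC.sqrt_nonneg A).posSemidef.isHermitian
  rwa [IsHermitian, conjTranspose_eq_transpose_of_trivial] at this

/-- The precision matrix of `A`-Gaussian integrals of `gaussRatio S`. -/
def tiltPrecision (S A : Matrix ι ι ℝ) : Matrix ι ι ℝ :=
  1 - A + CFC.sqrt A * S⁻¹ * CFC.sqrt A

lemma posDef_tiltPrecision {S A : Matrix ι ι ℝ} (hS : S.PosDef) (hA : A.PosSemidef)
    (hA1 : (1 - A).PosSemidef) : (tiltPrecision S A).PosDef := by
  set R := CFC.sqrt A with hR
  have hRR : R * R = A := CFC.sqrt_mul_sqrt_self _ hA.nonneg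
  have hRt : Rᵀ = R := transpose_sqrt A
  have hP : (R * S⁻¹ * R).PosSemidef := by
    have := hS.inv.posSemidef.conjTranspose_mul_mul_same R
    rwa [conjTranspose_eq_transpose_of_trivial, hRt] at this
  have hsw : ∀ v w : ι → ℝ, (R *ᵥ v) ⬝ᵥ w = v ⬝ᵥ R *ᵥ w := fun v w => by
    rw [dotProduct_mulVec, ← mulVec_transpose, hRt]
  refine Matrix.PosDef.of_dotProduct_mulVec_pos (hA1.add hP).isHermitian fun x hx => ?_
  have h1 := hA1.dotProduct_mulVec_nonneg x
  have h2 := hP.dotProduct_mulVec_nonneg x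
  rw [star_trivial] at *
  rw [tiltPrecision, ← hR, add_mulVec, dotProduct_add]
  refine lt_of_le_of_ne (add_nonneg h1 h2) fun h0 => hx ?_
  have h3 : x ⬝ᵥ (R * S⁻¹ * R) *ᵥ x = 0 := by linarith
  have h4 : x ⬝ᵥ (1 - A) *ᵥ x = 0 := by linarith
  rw [← mulVec_mulVec, ← mulVec_mulVec, ← hsw] at h3
  have h5 : R *ᵥ x = 0 := by
    by_contra hne
    have := hS.inv.dotProduct_mulVec_pos hne
    rw [star_trivial, h3] at this
    exact lt_irrefl _ this
  rw [sub_mulVec, one_mulVec, ← hRR, ← mulVec_mulVec, h5, mulVec_zero, sub_zero] at h4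
  exact dotProduct_self_eq_zero.1 h4

lemma det_mul_det_tiltPrecision_le_one {S A : Matrix ι ι ℝ} (hS : S.PosDef) (hA : A.PosSemidef)
    (hA1 : (1 - A).PosSemidef) (hSA : ((S - 1) * (1 - A)).trace = 0) :
    S.det * (tiltPrecision S A).det ≤ 1 := by
  set R := CFC.sqrt A with hR
  set C := CFC.sqrt (1 - A) with hC
  have hRR : R * R = A := CFC.sqrt_mul_sqrt_self _ hA.nonneg
  have hCC : C * C = 1 - A := CFC.sqrt_mul_sqrt_self _ hA1.nonneg
  have hCt : Cᵀ = C := transpose_sqrt (1 - A)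
  have hunit : IsUnit S.det := hS.det_pos.ne'.isUnit
  have e1 : tiltPrecision S A = 1 + R * ((S⁻¹ - 1) * R) := by
    rw [tiltPrecision, ← hR, sub_mul, mul_sub, one_mul, hRR]
    noncomm_ring
  have e2 : S * (1 + (S⁻¹ - 1) * R * R) = 1 + ((S - 1) * C) * C := by
    rw [mul_assoc, mul_assoc, hRR, hCC, mul_add, ← mul_assoc, mul_sub, mul_nonsing_inv _ hunit]
    noncomm_ring
  have e3 : S.det * (tiltPrecision S A).det = (1 + C * ((S - 1) * C)).det := by
    rw [e1, det_one_add_mul_comm, ← det_mul, e2, det_one_add_mul_comm]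
  have e4 : 1 + C * ((S - 1) * C) = A + C * S * C := by
    have : C * ((S - 1) * C) = C * S * C - C * C := by noncomm_ring
    rw [this, hCC]
    abel
  have hpsd : (1 + C * ((S - 1) * C)).PosSemidef := by
    rw [e4]
    have := hS.posSemidef.conjTranspose_mul_mul_same C
    rw [conjTranspose_eq_transpose_of_trivial, hCt] at this
    exact hA.add this
  rw [e3]
  refine hpsd.det_le_exp_trace_sub.trans (le_of_eq ?_)
  rw [add_sub_cancel_left, trace_mul_comm, mul_assoc, hCC, hSA, Real.exp_zero]

lemma one_le_lintegral_gaussRatio {S A : Matrix ι ι ℝ} (hS : S.PosDef) (hA : A.PosSemidef)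
    (hA1 : (1 - A).PosSemidef) (hSA : ((S - 1) * (1 - A)).trace = 0) :
    1 ≤ ∫⁻ x, ENNReal.ofReal (gaussRatio S x) ∂(multivariateGaussian 0 A) := by
  have hcont := continuous_gaussRatio S
  have hM := posDef_tiltPrecision hS hA hA1
  have hle := det_mul_det_tiltPrecision_le_one hS hA hA1 hSA
  rw [multivariateGaussian, lintegral_map (by fun_prop) (by fun_prop)]
  set R := CFC.sqrt A with hR
  have hRR : R * R = A := CFC.sqrt_mul_sqrt_self _ hA.nonneg
  have hRt : Rᵀ = R := transpose_sqrt A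
  have hsw : ∀ v w : ι → ℝ, (R *ᵥ v) ⬝ᵥ w = v ⬝ᵥ R *ᵥ w := fun v w => by
    rw [dotProduct_mulVec, ← mulVec_transpose, hRt]
  have hd : 0 < √S.det := Real.sqrt_pos.2 hS.det_pos
  have hd' : 0 < √(tiltPrecision S A).det := Real.sqrt_pos.2 hM.det_pos
  have e : ∀ x : EuclideanSpace ℝ ι,
      ENNReal.ofReal (gaussRatio S (0 + toEuclideanCLM (𝕜 := ℝ) R x)) =
      ENNReal.ofReal (√S.det)⁻¹ *
        ENNReal.ofReal (Real.exp ((x ⬝ᵥ x - x ⬝ᵥ tiltPrecision S A *ᵥ x) / 2)) := by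
    intro x
    rw [zero_add, gaussRatio, ENNReal.ofReal_mul (by positivity), ofLp_toEuclideanCLM,
      hsw, hsw, mulVec_mulVec, mulVec_mulVec, mulVec_mulVec, hRR, tiltPrecision, ← hR, add_mulVec,
      sub_mulVec, one_mulVec, dotProduct_add, dotProduct_sub]
    congr 4
    ring
  simp only [e]
  rw [lintegral_const_mul' _ _ ENNReal.ofReal_ne_top, lintegral_exp_quadratic hM,
    ← ENNReal.ofReal_mul (by positivity), ENNReal.one_le_ofReal, ← mul_inv,
    ← Real.sqrt_mul hS.det_pos.le]
  refine (one_le_inv₀ (Real.sqrt_pos.2 (mul_pos hS.det_pos hM.det_pos))).2 ?_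
  exact Real.sqrt_le_iff.2 ⟨zero_le_one, by simpa using hle⟩

end GaussianCase

section CrudeBound

variable {E : Type*} [NormedAddCommGroup E] [InnerProductSpace ℝ E] [FiniteDimensional ℝ E]
  [MeasurableSpace E] [BorelSpace E]

/-- A positive continuous function has mean bounded below over probability measures of bounded
second moment. -/
lemma exists_le_lintegral_of_lintegral_norm_sq_le {K : E → ℝ} (hK : Continuous K)
    (hK0 : ∀ x, 0 < K x) (C : ℝ) (hC : 0 ≤ C) :
    ∃ κ : ℝ≥0∞, κ ≠ 0 ∧ ∀ ν : Measure E, IsProbabilityMeasure ν →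
      ∫⁻ x, ENNReal.ofReal (‖x‖ ^ 2) ∂ν ≤ ENNReal.ofReal C →
        κ ≤ ∫⁻ x, ENNReal.ofReal (K x) ∂ν := by
  set R : ℝ := √(2 * C + 1) with hR
  have hR2 : R ^ 2 = 2 * C + 1 := Real.sq_sqrt (by positivity)
  obtain ⟨x₀, -, hx₀⟩ := (isCompact_closedBall (0 : E) R).exists_isMinOn
    ⟨0, by simp [hR]⟩ hK.continuousOn
  refine ⟨ENNReal.ofReal (K x₀) * 2⁻¹, mul_ne_zero (by simpa using hK0 x₀) (by simp),
    fun ν _ hν => ?_⟩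
  have hball : (2⁻¹ : ℝ≥0∞) ≤ ν (Metric.closedBall 0 R) := by
    have hcompl : ν (Metric.closedBall 0 R)ᶜ ≤ 2⁻¹ := by
      have hsub : (Metric.closedBall (0 : E) R)ᶜ ⊆
          {x | ENNReal.ofReal (2 * C + 1) ≤ ENNReal.ofReal (‖x‖ ^ 2)} := by
        intro x hx
        simp only [Set.mem_compl_iff, Metric.mem_closedBall, dist_zero_right, not_le] at hx
        refine ENNReal.ofReal_le_ofReal ?_
        rw [← hR2]
        have : 0 ≤ R := Real.sqrt_nonneg _
        gcongr
      refine (measure_mono hsub).trans ((meas_ge_le_lintegral_div (by fun_prop)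
        (by simp; positivity) ENNReal.ofReal_ne_top).trans ?_)
      refine (ENNReal.div_le_div_right hν _).trans ?_
      rw [← ENNReal.ofReal_div_of_pos (by positivity)]
      have : (2⁻¹ : ℝ≥0∞) = ENNReal.ofReal 2⁻¹ := by
        rw [ENNReal.ofReal_inv_of_pos (by norm_num)]; simp
      rw [this]
      refine ENNReal.ofReal_le_ofReal ?_
      rw [div_le_iff₀ (by positivity)]
      linarith
    have h1 := prob_add_prob_compl (μ := ν) (s := Metric.closedBall 0 R)
      Metric.isClosed_closedBall.measurableSet
    by_contra! hlt
    have : ν (Metric.closedBall 0 R) + ν (Metric.closedBall 0 R)ᶜ < 2⁻¹ + 2⁻¹ :=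
      ENNReal.add_lt_add_of_lt_of_le (ne_top_of_le_ne_top (by simp) hcompl) hlt hcompl
    rw [h1, ENNReal.inv_two_add_inv_two] at this
    exact this.false
  calc ENNReal.ofReal (K x₀) * 2⁻¹
      ≤ ENNReal.ofReal (K x₀) * ν (Metric.closedBall 0 R) := by gcongr
    _ = ∫⁻ _ in Metric.closedBall 0 R, ENNReal.ofReal (K x₀) ∂ν := by simp
    _ ≤ ∫⁻ x in Metric.closedBall 0 R, ENNReal.ofReal (K x) ∂ν :=
        setLIntegral_mono' Metric.isClosed_closedBall.measurableSet
          fun x hx => ENNReal.ofReal_le_ofReal (hx₀ hx)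
    _ ≤ _ := setLIntegral_le_lintegral _ _

end CrudeBound

section EvenStage

variable {ι α : Type*} [DecidableEq α] [Fintype ι] [DecidableEq ι]
variable {b : ι → α} {F : EuclideanSpace ℝ ι → ℝ≥0∞} {S : Matrix ι ι ℝ}

lemma mul_lintegral_double_le (hF : IsBlockLogConcave b F) {c : ℝ≥0∞}
    (hc : ∀ G, IsBlockLogConcave b G → (∀ x, G (-x) = G x) →
      c * ∫⁻ x, G x ∂(stdGaussian (EuclideanSpace ℝ ι)) ≤ ∫⁻ x, G x ∂(multivariateGaussian 0 S)) :
    c * ∫⁻ x, double F x ∂(multivariateGaussian 0 S) ≤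
      (∫⁻ x, F x ∂(multivariateGaussian 0 S)) ^ 2 := by
  have h := lintegral_prod_rotate (multivariateGaussian 0 S) integral_id_multivariateGaussian'
    (G := fun p : EuclideanSpace ℝ ι × EuclideanSpace ℝ ι => F p.1 * F p.2)
    ((hF.measurable.comp measurable_fst).mul (hF.measurable.comp measurable_snd))
  rw [lintegral_prod_mul hF.measurable.aemeasurable hF.measurable.aemeasurable, ← sq] at h
  rw [← h, ← lintegral_const_mul _ hF.double.measurable]
  exact lintegral_mono fun u => hc _ (hF.rotSlice u) (rotSlice_neg F u)

lemma pow_mul_lintegral_iterate_double_le (hF : IsBlockLogConcave b F) {c : ℝ≥0∞}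
    (hc : ∀ G, IsBlockLogConcave b G → (∀ x, G (-x) = G x) →
      c * ∫⁻ x, G x ∂(stdGaussian (EuclideanSpace ℝ ι)) ≤ ∫⁻ x, G x ∂(multivariateGaussian 0 S))
    (n : ℕ) :
    c ^ (2 ^ n - 1) * ∫⁻ x, double^[n] F x ∂(multivariateGaussian 0 S) ≤
      (∫⁻ x, F x ∂(multivariateGaussian 0 S)) ^ 2 ^ n := by
  induction n with
  | zero => simp
  | succ n ih =>
    have h := mul_lintegral_double_le (hF.iterate_double n) hc
    have e : 2 ^ (n + 1) - 1 = (2 ^ n - 1) * 2 + 1 := by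
      have := Nat.one_le_two_pow (n := n)
      rw [pow_succ]
      omega
    rw [Function.iterate_succ_apply', e, pow_succ, mul_assoc]
    refine (mul_le_mul_right h _).trans ?_
    rw [pow_mul, ← mul_pow, pow_succ 2 n, pow_mul]
    gcongr

lemma gaussRatio_pos (hS : S.PosDef) (x : EuclideanSpace ℝ ι) : 0 < gaussRatio S x :=
  mul_pos (inv_pos.2 (Real.sqrt_pos.2 hS.det_pos)) (Real.exp_pos _)

lemma lintegral_gaussRatio_gaussTilt (hS : S.PosDef) (hF : Measurable F) :
    ∫⁻ x, ENNReal.ofReal (gaussRatio S x) ∂(gaussTilt F) =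
      (∫⁻ x, F x ∂(stdGaussian (EuclideanSpace ℝ ι)))⁻¹ *
        ∫⁻ x, F x ∂(multivariateGaussian 0 S) := by
  rw [lintegral_gaussTilt hF (continuous_gaussRatio S).measurable.ennreal_ofReal,
    lintegral_multivariateGaussian hS hF]
  simp only [mul_comm (F _)]

lemma mul_lintegral_le_of_le_lintegral_gaussRatio (hS : S.PosDef) (hF : IsBlockLogConcave b F)
    (h0 : ∫⁻ x, F x ∂(stdGaussian (EuclideanSpace ℝ ι)) ≠ 0) {κ : ℝ≥0∞}
    (h : κ ≤ ∫⁻ x, ENNReal.ofReal (gaussRatio S x) ∂(gaussTilt F)) :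
    κ * ∫⁻ x, F x ∂(stdGaussian (EuclideanSpace ℝ ι)) ≤
      ∫⁻ x, F x ∂(multivariateGaussian 0 S) := by
  have htop := ne_top_of_le_ne_top (by simp) hF.lintegral_le_one
  rw [lintegral_gaussRatio_gaussTilt hS hF.measurable, mul_comm, ← div_eq_mul_inv] at h
  exact (ENNReal.le_div_iff_mul_le (Or.inl h0) (Or.inl htop)).1 h

omit [DecidableEq ι] in
lemma IsBlockLogConcave.lintegral_norm_sq_gaussTilt_le (hF : IsBlockLogConcave b F)
    (he : ∀ x, F (-x) = F x)
    (h0 : ∫⁻ x, F x ∂(stdGaussian (EuclideanSpace ℝ ι)) ≠ 0) :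
    ∫⁻ x, ENNReal.ofReal (‖x‖ ^ 2) ∂(gaussTilt F) ≤ ENNReal.ofReal (Fintype.card ι) := by
  have hi : ∀ i, Integrable (fun x : EuclideanSpace ℝ ι => x i ^ 2) (gaussTilt F) := fun i => by
    simpa [sq] using hF.integrable_mul he h0 i i
  simp only [EuclideanSpace.real_norm_sq_eq]
  rw [← ofReal_integral_eq_lintegral_ofReal (integrable_finsetSum _ fun i _ => hi i)
    (Filter.Eventually.of_forall fun x => Finset.sum_nonneg fun i _ => sq_nonneg _),
    integral_finsetSum _ fun i _ => hi i]
  refine ENNReal.ofReal_le_ofReal ((Finset.sum_le_card_nsmul _ _ 1 fun i _ => ?_).trans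
    (le_of_eq (by simp)))
  have := le_of_abs_le (hF.abs_secondMoment_le he h0 i i)
  simpa [secondMoment, sq] using this

/-- Among centered Gaussian measures with identity diagonal blocks, the standard one gives the
least mass to even block log-concave functions. -/
lemma lintegral_stdGaussian_le_of_even (hS : S.PosDef)
    (hSb : ∀ i j, b i = b j → S i j = (1 : Matrix ι ι ℝ) i j)
    (hF : IsBlockLogConcave b F) (he : ∀ x, F (-x) = F x) :
    ∫⁻ x, F x ∂(stdGaussian (EuclideanSpace ℝ ι)) ≤ ∫⁻ x, F x ∂(multivariateGaussian 0 S) := by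
  set T : Set ℝ≥0∞ := {c | ∀ G, IsBlockLogConcave b G → (∀ x, G (-x) = G x) →
    c * ∫⁻ x, G x ∂(stdGaussian (EuclideanSpace ℝ ι)) ≤ ∫⁻ x, G x ∂(multivariateGaussian 0 S)}
    with hT
  set I := sSup T with hI
  have hIT : I ∈ T := by
    intro G hG hGe
    rw [hI, ENNReal.sSup_mul]
    exact iSup₂_le fun c hc => hc G hG hGe
  suffices h1 : 1 ≤ I by
    simpa using (mul_le_mul_left h1 _).trans (hIT F hF he)
  by_contra! hlt
  obtain ⟨c, hIc, hc1⟩ := exists_between hlt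
  have hIpos : I ≠ 0 := by
    obtain ⟨κ, hκ, h⟩ := exists_le_lintegral_of_lintegral_norm_sq_le (continuous_gaussRatio S)
      (gaussRatio_pos hS) (Fintype.card ι) (by positivity)
    refine fun h0 => hκ (le_antisymm ?_ zero_le)
    rw [← h0]
    refine le_sSup fun G hG hGe => ?_
    by_cases hG0 : ∫⁻ x, G x ∂(stdGaussian (EuclideanSpace ℝ ι)) = 0
    · simp [hG0]
    · exact mul_lintegral_le_of_le_lintegral_gaussRatio hS hG hG0
        (h _ (hG.isProbabilityMeasure hG0) (hG.lintegral_norm_sq_gaussTilt_le hGe hG0))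
  have hIt : I ≠ ∞ := hlt.ne_top
  have key : ∀ n : ℕ, ∃ G, IsBlockLogConcave b G ∧ (∀ x, G (-x) = G x) ∧
      ∫⁻ x, double^[n] G x ∂(multivariateGaussian 0 S) <
        c * ∫⁻ x, double^[n] G x ∂(stdGaussian (EuclideanSpace ℝ ι)) := by
    intro n
    by_contra! hcon
    have hn : (2 ^ n : ℕ) ≠ 0 := by positivity
    set c' : ℝ≥0∞ := (I ^ (2 ^ n - 1) * c) ^ (((2 ^ n : ℕ) : ℝ)⁻¹) with hc'
    have hpow : c' ^ 2 ^ n = I ^ (2 ^ n - 1) * c := by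
      rw [hc', ← ENNReal.rpow_natCast, ← ENNReal.rpow_mul,
        inv_mul_cancel₀ (by exact_mod_cast hn), ENNReal.rpow_one]
    have hlt' : I ^ 2 ^ n < c' ^ 2 ^ n := by
      have e : I ^ 2 ^ n = I ^ (2 ^ n - 1) * I := by
        rw [← pow_succ]; congr 1; have := Nat.one_le_two_pow (n := n); omega
      rw [hpow, e]
      exact ENNReal.mul_lt_mul_right (pow_ne_zero _ hIpos) (ENNReal.pow_ne_top hIt) hIc
    have hIc' : I < c' := lt_of_not_ge fun h => hlt'.not_ge (pow_le_pow_left' h _)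
    refine hIc'.not_ge (le_sSup fun G hG hGe => ?_)
    refine (ENNReal.pow_le_pow_left_iff hn).1 ?_
    rw [mul_pow, hpow, mul_assoc, ← lintegral_iterate_double hG]
    exact (mul_le_mul_right (hcon G hG hGe) _).trans (pow_mul_lintegral_iterate_double_le hG hIT n)
  choose G hG hGe hGlt using key
  have hG0 : ∀ n, ∫⁻ x, G n x ∂(stdGaussian (EuclideanSpace ℝ ι)) ≠ 0 := fun n h0 => by
    have := hGlt n
    rw [lintegral_iterate_double (hG n), h0, zero_pow (by positivity)] at this
    simp at this
  obtain ⟨A, φ, -, hA, hA1, hAb, hlim⟩ := exists_tendsto_charFun_gaussTilt hG hGe hG0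
  have hD0 : ∀ n, ∫⁻ x, double^[n] (G n) x ∂(stdGaussian (EuclideanSpace ℝ ι)) ≠ 0 := fun n => by
    rw [lintegral_iterate_double (hG n)]; exact pow_ne_zero _ (hG0 n)
  have hprob : ∀ n, IsProbabilityMeasure (gaussTilt (double^[φ n] (G (φ n)))) := fun n =>
    ((hG _).iterate_double _).isProbabilityMeasure (hD0 _)
  have htr : ((S - 1) * (1 - A)).trace = 0 := by
    rw [Matrix.trace]
    refine Finset.sum_eq_zero fun i _ => ?_
    rw [Matrix.diag_apply, Matrix.mul_apply]
    refine Finset.sum_eq_zero fun j _ => ?_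
    by_cases hij : b i = b j
    · simp [hSb i j hij]
    · have hji : j ≠ i := fun h => hij (by rw [h])
      simp [hAb j i (Ne.symm hij), Matrix.one_apply_ne hji]
  have hle := (one_le_lintegral_gaussRatio hS hA hA1 htr).trans
    (lintegral_le_liminf_of_tendsto_charFun hlim (continuous_gaussRatio S)
      fun x => (gaussRatio_pos hS x).le)
  refine hc1.not_ge (hle.trans ?_)
  refine Filter.liminf_le_of_frequently_le' (Filter.Frequently.of_forall fun n => ?_)
  rw [lintegral_gaussRatio_gaussTilt hS ((hG _).iterate_double _).measurable, mul_comm,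
    ← div_eq_mul_inv]
  exact ENNReal.div_le_of_le_mul (hGlt _).le

end EvenStage

section NormalizedSum

variable {E : Type*} [NormedAddCommGroup E] [InnerProductSpace ℝ E] [FiniteDimensional ℝ E]
  [MeasurableSpace E] [BorelSpace E]

/-- Square integrable, centered, with second moment `M`. -/
structure HasCenteredSecondMoment (ν : Measure E) (M : ℝ) : Prop where
  memLp : MemLp id 2 ν
  integral_eq_zero : ∫ x, x ∂ν = 0
  integral_norm_sq : ∫ x, ‖x‖ ^ 2 ∂ν = M

/-- The normalised sum of two independent centered variables has the same second moment. -/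
lemma HasCenteredSecondMoment.normalized_conv {ν : Measure E} [IsProbabilityMeasure ν] {M : ℝ}
    (h : HasCenteredSecondMoment ν M) :
    HasCenteredSecondMoment ((ν ∗ ν).map ((√2)⁻¹ • ·)) M := by
  have hmap : (ν ∗ ν).map ((√2)⁻¹ • ·) =
      (ν.prod ν).map fun p : E × E => (√2)⁻¹ • (p.1 + p.2) := by
    rw [Measure.conv, Measure.map_map (by fun_prop) (by fun_prop)]
    rfl
  have h1 : MemLp (fun p : E × E => p.1) 2 (ν.prod ν) :=
    h.memLp.comp_measurePreserving measurePreserving_fst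
  have h2 : MemLp (fun p : E × E => p.2) 2 (ν.prod ν) :=
    h.memLp.comp_measurePreserving measurePreserving_snd
  have h12 : Integrable (fun p : E × E => ⟪p.1, p.2⟫) (ν.prod ν) :=
    (h1.norm.integrable_mul h2.norm).mono' (by fun_prop)
      (Filter.Eventually.of_forall fun p => norm_inner_le_norm p.1 p.2)
  have hid : Integrable (fun x : E => x) ν := h.memLp.integrable (by norm_num)
  have hf : ∫ p : E × E, p.1 ∂(ν.prod ν) = 0 := by
    rw [integral_fun_fst (f := fun x : E => x)]; simp [h.integral_eq_zero]
  have hs : ∫ p : E × E, p.2 ∂(ν.prod ν) = 0 := by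
    rw [integral_fun_snd (f := fun x : E => x)]; simp [h.integral_eq_zero]
  have hin : ∫ p : E × E, ⟪p.1, p.2⟫ ∂(ν.prod ν) = 0 := by
    rw [integral_prod _ h12]
    simp [integral_inner hid, h.integral_eq_zero]
  have hnf : ∫ p : E × E, ‖p.1‖ ^ 2 ∂(ν.prod ν) = M := by
    rw [integral_fun_fst (f := fun x : E => ‖x‖ ^ 2)]; simp [h.integral_norm_sq]
  have hns : ∫ p : E × E, ‖p.2‖ ^ 2 ∂(ν.prod ν) = M := by
    rw [integral_fun_snd (f := fun x : E => ‖x‖ ^ 2)]; simp [h.integral_norm_sq]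
  rw [hmap]
  refine ⟨?_, ?_, ?_⟩
  · rw [memLp_map_measure_iff (by fun_prop) (by fun_prop)]
    exact (h1.add h2).const_smul _
  · rw [integral_map (by fun_prop) (by fun_prop), integral_smul,
      integral_add (h1.integrable (by norm_num)) (h2.integrable (by norm_num)), hf, hs]
    simp
  · rw [integral_map (by fun_prop) (by fun_prop)]
    have e : ∀ p : E × E, ‖(√2)⁻¹ • (p.1 + p.2)‖ ^ 2 =
        2⁻¹ * (‖p.1‖ ^ 2 + 2 * ⟪p.1, p.2⟫ + ‖p.2‖ ^ 2) := by
      intro p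
      rw [norm_smul, mul_pow, norm_add_sq_real]
      congr 1
      simp
    have i1 : Integrable (fun p : E × E => ‖p.1‖ ^ 2) (ν.prod ν) :=
      h1.integrable_norm_pow (by norm_num)
    have i2 : Integrable (fun p : E × E => ‖p.2‖ ^ 2) (ν.prod ν) :=
      h2.integrable_norm_pow (by norm_num)
    have i3 : Integrable (fun p : E × E => 2 * ⟪p.1, p.2⟫) (ν.prod ν) :=
      h12.const_mul 2
    simp only [e]
    rw [integral_const_mul,
      integral_add (f := fun p : E × E => ‖p.1‖ ^ 2 + 2 * ⟪p.1, p.2⟫) (i1.add i3) i2,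
      integral_add i1 i3,
      integral_const_mul, hin, hnf, hns]
    ring

end NormalizedSum

section CenteredStage

variable {ι α : Type*} [DecidableEq α] [Fintype ι]
variable {b : ι → α} {F : EuclideanSpace ℝ ι → ℝ≥0∞}

lemma IsBlockLogConcave.memLp_id_gaussTilt (hF : IsBlockLogConcave b F)
    (h0 : ∫⁻ x, F x ∂(stdGaussian (EuclideanSpace ℝ ι)) ≠ 0) :
    MemLp id 2 (gaussTilt F) := by
  have h : MemLp id 2 (stdGaussian (EuclideanSpace ℝ ι)) := IsGaussian.memLp_two_id
  refine h.of_measure_le_smul (ENNReal.inv_ne_top.2 h0) ?_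
  rw [gaussTilt]
  gcongr
  calc (stdGaussian (EuclideanSpace ℝ ι)).withDensity F
      ≤ (stdGaussian (EuclideanSpace ℝ ι)).withDensity 1 :=
        withDensity_mono (Filter.Eventually.of_forall hF.le_one)
    _ = _ := withDensity_one

lemma hasCenteredSecondMoment_gaussTilt_iterate_double (hF : IsBlockLogConcave b F)
    (h0 : ∫⁻ x, F x ∂(stdGaussian (EuclideanSpace ℝ ι)) ≠ 0) {M : ℝ}
    (h : HasCenteredSecondMoment (gaussTilt F) M) (n : ℕ) :
    HasCenteredSecondMoment (gaussTilt (double^[n] F)) M := by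
  induction n with
  | zero => exact h
  | succ n ih =>
    have h1 : ∫⁻ x, double^[n] F x ∂(stdGaussian (EuclideanSpace ℝ ι)) ≠ 0 := by
      rw [lintegral_iterate_double hF]; exact pow_ne_zero _ h0
    have := (hF.iterate_double n).isProbabilityMeasure h1
    rw [Function.iterate_succ_apply', gaussTilt_double (hF.iterate_double n) h1]
    exact ih.normalized_conv

variable [DecidableEq ι] {S : Matrix ι ι ℝ}

/-- Among centered Gaussian measures with identity diagonal blocks, the standard one gives the
least mass to block log-concave functions whose Gaussian barycenter is the origin. -/
lemma lintegral_stdGaussian_le_of_centered (hS : S.PosDef)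
    (hSb : ∀ i j, b i = b j → S i j = (1 : Matrix ι ι ℝ) i j)
    (hF : IsBlockLogConcave b F) (hc : ∫ x, x ∂(gaussTilt F) = 0) :
    ∫⁻ x, F x ∂(stdGaussian (EuclideanSpace ℝ ι)) ≤ ∫⁻ x, F x ∂(multivariateGaussian 0 S) := by
  by_cases h0 : ∫⁻ x, F x ∂(stdGaussian (EuclideanSpace ℝ ι)) = 0
  · simp [h0]
  have htop := ne_top_of_le_ne_top (by simp) hF.lintegral_le_one
  set M : ℝ := ∫ x, ‖x‖ ^ 2 ∂(gaussTilt F) with hM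
  obtain ⟨κ, hκ, hκ'⟩ := exists_le_lintegral_of_lintegral_norm_sq_le (continuous_gaussRatio S)
    (gaussRatio_pos hS) M (by positivity)
  have hpow : ∀ n : ℕ, κ ≤ ((∫⁻ x, F x ∂(multivariateGaussian 0 S)) /
      ∫⁻ x, F x ∂(stdGaussian (EuclideanSpace ℝ ι))) ^ 2 ^ n := by
    intro n
    have h1 : ∫⁻ x, double^[n] F x ∂(stdGaussian (EuclideanSpace ℝ ι)) ≠ 0 := by
      rw [lintegral_iterate_double hF]; exact pow_ne_zero _ h0
    have hm := hasCenteredSecondMoment_gaussTilt_iterate_double hF h0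
      ⟨hF.memLp_id_gaussTilt h0, hc, hM.symm⟩ n
    have hle := mul_lintegral_le_of_le_lintegral_gaussRatio hS (hF.iterate_double n) h1
      (hκ' _ ((hF.iterate_double n).isProbabilityMeasure h1) (by
        rw [← ofReal_integral_eq_lintegral_ofReal
          (f := fun x : EuclideanSpace ℝ ι => ‖x‖ ^ 2) (hm.memLp.integrable_norm_pow (by norm_num))
          (Filter.Eventually.of_forall fun x => by positivity)]
        exact ENNReal.ofReal_le_ofReal hm.integral_norm_sq.le))
    have hd := pow_mul_lintegral_iterate_double_le (S := S) (c := 1) hF (fun G hG he => by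
      rw [one_mul]; exact lintegral_stdGaussian_le_of_even hS hSb hG he) n
    rw [one_pow, one_mul] at hd
    rw [lintegral_iterate_double hF] at hle
    rw [div_eq_mul_inv, mul_pow, ← ENNReal.inv_pow, ← div_eq_mul_inv]
    exact (ENNReal.le_div_iff_mul_le (Or.inl (pow_ne_zero _ h0))
      (Or.inl (ENNReal.pow_ne_top htop))).2 (hle.trans hd)
  by_contra! hlt
  have hq : (∫⁻ x, F x ∂(multivariateGaussian 0 S)) /
      ∫⁻ x, F x ∂(stdGaussian (EuclideanSpace ℝ ι)) < 1 :=
    (ENNReal.div_lt_iff (Or.inl h0) (Or.inl htop)).2 (by simpa using hlt)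
  have ht := (ENNReal.tendsto_pow_atTop_nhds_zero_of_lt_one hq).comp
    (tendsto_pow_atTop_atTop_of_one_lt (one_lt_two (α := ℕ)))
  exact hκ (le_antisymm (ge_of_tendsto' ht hpow) zero_le)

end CenteredStage

section Singular

variable {ι α : Type*} [DecidableEq α] [Fintype ι] [DecidableEq ι]
variable {b : ι → α} {S : Matrix ι ι ℝ}

/-- Version for closed sets, allowing degenerate covariance matrices. -/
lemma stdGaussian_le_multivariateGaussian (hS : S.PosSemidef)
    (hSb : ∀ i j, b i = b j → S i j = (1 : Matrix ι ι ℝ) i j) {K : Set (EuclideanSpace ℝ ι)}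
    (hK : IsClosed K) (hF : IsBlockLogConcave b (K.indicator 1))
    (hc : ∫ x, x ∂(gaussTilt (K.indicator 1)) = 0) :
    stdGaussian (EuclideanSpace ℝ ι) K ≤ multivariateGaussian 0 S K := by
  let ε : ℕ → ℝ := fun n => 1 / ((n : ℝ) + 1)
  have hε0 : ∀ n, 0 < ε n := fun n => Nat.one_div_pos_of_nat
  have hε1 : ∀ n, ε n ≤ 1 := fun n => by
    simp only [ε]; rw [div_le_one (by positivity)]; linarith [(Nat.cast_nonneg n : (0 : ℝ) ≤ n)]
  have hεt : Filter.Tendsto ε Filter.atTop (nhds 0) := tendsto_one_div_add_atTop_nhds_zero_nat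
  let T : ℕ → Matrix ι ι ℝ := fun n => (1 - ε n) • S + ε n • 1
  have hT : ∀ n, (T n).PosDef := fun n =>
    Matrix.PosDef.posSemidef_add (hS.smul (sub_nonneg.2 (hε1 n))) (Matrix.PosDef.one.smul (hε0 n))
  have hTb : ∀ n i j, b i = b j → T n i j = (1 : Matrix ι ι ℝ) i j := fun n i j hij => by
    simp only [T, Matrix.add_apply, Matrix.smul_apply, hSb i j hij, smul_eq_mul]
    ring
  have hle : ∀ n, stdGaussian (EuclideanSpace ℝ ι) K ≤ multivariateGaussian 0 (T n) K := fun n => by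
    have := lintegral_stdGaussian_le_of_centered (hT n) (hTb n) hF hc
    rwa [lintegral_indicator_one hK.measurableSet, lintegral_indicator_one hK.measurableSet] at this
  let νp : ℕ → ProbabilityMeasure (EuclideanSpace ℝ ι) :=
    fun n => ⟨multivariateGaussian 0 (T n), inferInstance⟩
  let ν₀p : ProbabilityMeasure (EuclideanSpace ℝ ι) := ⟨multivariateGaussian 0 S, inferInstance⟩
  have ht : Filter.Tendsto νp Filter.atTop (nhds ν₀p) := by
    refine ProbabilityMeasure.tendsto_of_tendsto_charFun fun ξ => ?_
    change Filter.Tendsto (fun n => charFun (multivariateGaussian 0 (T n)) ξ) _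
      (nhds (charFun (multivariateGaussian 0 S) ξ))
    simp only [charFun_multivariateGaussian (hT _).posSemidef, charFun_multivariateGaussian hS]
    have hTS : Filter.Tendsto T Filter.atTop (nhds S) := by
      have h1 : Continuous fun t : ℝ => (1 - t) • S + t • (1 : Matrix ι ι ℝ) := by fun_prop
      have := (h1.tendsto 0).comp hεt
      simp only [sub_zero, one_smul, zero_smul, add_zero] at this
      exact this
    have hq : Continuous fun A : Matrix ι ι ℝ =>
        Complex.exp (((⟪ξ, (0 : EuclideanSpace ℝ ι)⟫ : ℝ) : ℂ) * Complex.I -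
          ((ξ ⬝ᵥ A *ᵥ ξ : ℝ) : ℂ) / 2) := by
      have hc : Continuous fun M : Matrix ι ι ℝ => ξ ⬝ᵥ M *ᵥ ξ :=
        Continuous.dotProduct continuous_const (continuous_id.matrix_mulVec continuous_const)
      fun_prop
    exact (hq.tendsto S).comp hTS
  have hlim := ProbabilityMeasure.limsup_measure_closed_le_of_tendsto ht hK
  refine le_trans ?_ hlim
  exact Filter.le_limsup_of_frequently_le' (Filter.Frequently.of_forall fun n => hle n)

end Singular

section BlockCentering

variable {α β : Type*} [Fintype α] [Fintype β]

/-- The mean of the coordinates of `y` in block `a`. -/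
def blockMean (y : EuclideanSpace ℝ (α × β)) (a : α) : ℝ :=
  (Fintype.card β : ℝ)⁻¹ * ∑ j, y (a, j)

omit [Fintype α] in
lemma continuous_blockMean (a : α) :
    Continuous fun y : EuclideanSpace ℝ (α × β) => blockMean y a := by
  unfold blockMean
  fun_prop

/-- The vectors whose coordinates exceed the mean of their block by at most `t`. -/
def blockCenteredLE (t : ℝ) : Set (EuclideanSpace ℝ (α × β)) :=
  {y | ∀ p : α × β, y p - blockMean y p.1 ≤ t}

omit [Fintype α] in
lemma isClosed_blockCenteredLE (t : ℝ) :
    IsClosed (blockCenteredLE t : Set (EuclideanSpace ℝ (α × β))) := by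
  simp only [blockCenteredLE, Set.ofPred_forall]
  refine isClosed_iInter fun p => isClosed_le ?_ continuous_const
  have := continuous_blockMean (α := α) (β := β) p.1
  fun_prop

omit [Fintype α] in
lemma blockMean_blockMix [DecidableEq α] (a c : α) (x y : EuclideanSpace ℝ (α × β)) :
    blockMean (blockMix Prod.fst a x y) c = if c = a then blockMean x c else blockMean y c := by
  by_cases h : c = a <;> simp [blockMean, h]

lemma isBlockLogConcave_indicator_blockCenteredLE [DecidableEq α] (t : ℝ) :
    IsBlockLogConcave Prod.fst
      ((blockCenteredLE t : Set (EuclideanSpace ℝ (α × β))).indicator 1) where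
  measurable := measurable_one.indicator (isClosed_blockCenteredLE t).measurableSet
  le_one x := Set.indicator_le_self' (fun _ _ => zero_le) x
  mul_le_sq x y := by
    classical
    by_cases h : x ∈ (blockCenteredLE t : Set (EuclideanSpace ℝ (α × β))) ∧
        y ∈ (blockCenteredLE t : Set (EuclideanSpace ℝ (α × β)))
    · have hxy : (2⁻¹ : ℝ) • (x + y) ∈
          (blockCenteredLE t : Set (EuclideanSpace ℝ (α × β))) := by
        intro p
        have h1 := h.1 p
        have h2 := h.2 p
        have e : blockMean ((2⁻¹ : ℝ) • (x + y)) p.1 =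
            2⁻¹ * (blockMean x p.1 + blockMean y p.1) := by
          simp only [blockMean, PiLp.smul_apply, PiLp.add_apply, smul_eq_mul, ← Finset.mul_sum,
            Finset.sum_add_distrib]
          ring
        rw [e, PiLp.smul_apply, PiLp.add_apply, smul_eq_mul]
        linarith
      rw [Set.indicator_of_mem hxy, Set.indicator_of_mem h.1, Set.indicator_of_mem h.2]
      simp
    · rw [not_and_or] at h
      rcases h with h | h <;> simp [Set.indicator_of_notMem h]
  mul_eq a x y := by
    classical
    have hiff : (x ∈ (blockCenteredLE t : Set (EuclideanSpace ℝ (α × β))) ∧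
        y ∈ (blockCenteredLE t : Set (EuclideanSpace ℝ (α × β)))) ↔
        (blockMix Prod.fst a x y ∈ (blockCenteredLE t : Set (EuclideanSpace ℝ (α × β))) ∧
          blockMix Prod.fst a y x ∈ (blockCenteredLE t : Set (EuclideanSpace ℝ (α × β)))) := by
      simp only [blockCenteredLE, Set.mem_ofPred_eq, blockMean_blockMix, blockMix_apply,
        ← forall_and]
      refine forall_congr' fun p => ?_
      by_cases h : p.1 = a <;> simp [h, and_comm]
    simp only [Set.indicator_apply, Pi.one_apply, ite_zero_mul_ite_zero, mul_one]
    simp only [hiff]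

/-- Reflection negating the mean of each block. -/
def blockMeanReflection [Nonempty β] :
    EuclideanSpace ℝ (α × β) ≃ₗᵢ[ℝ] EuclideanSpace ℝ (α × β) :=
  LinearIsometry.toLinearIsometryEquiv
    { toFun := fun y => WithLp.toLp 2 fun p => y p - 2 * blockMean y p.1
      map_add' := fun x y => by
        ext p
        simp only [blockMean, PiLp.add_apply, Finset.sum_add_distrib]
        ring
      map_smul' := fun c x => by
        ext p
        simp only [blockMean, PiLp.smul_apply, smul_eq_mul, ← Finset.mul_sum, RingHom.id_apply]
        ring
      norm_map' := fun y => by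
        rw [← sq_eq_sq₀ (norm_nonneg _) (norm_nonneg _)]
        simp only [LinearMap.coe_mk, AddHom.coe_mk, EuclideanSpace.real_norm_sq_eq,
          Fintype.sum_prod_type]
        refine Finset.sum_congr rfl fun a _ => ?_
        have hc : (Fintype.card β : ℝ) ≠ 0 := by exact_mod_cast Fintype.card_ne_zero
        have hs : ∑ j, y (a, j) = Fintype.card β * blockMean y a := by
          rw [blockMean]; field_simp
        simp only [sub_sq, Finset.sum_add_distrib, Finset.sum_sub_distrib, Finset.sum_const,
          ← Finset.mul_sum, ← Finset.sum_mul, hs, Finset.card_univ, nsmul_eq_mul]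
        ring } rfl

lemma blockMeanReflection_apply [Nonempty β] (y : EuclideanSpace ℝ (α × β)) (p : α × β) :
    blockMeanReflection y p = y p - 2 * blockMean y p.1 := rfl

lemma blockMean_blockMeanReflection [Nonempty β] (y : EuclideanSpace ℝ (α × β)) (a : α) :
    blockMean (blockMeanReflection y) a = -blockMean y a := by
  have hc : (Fintype.card β : ℝ) ≠ 0 := by exact_mod_cast Fintype.card_ne_zero
  have hs : ∑ j, y (a, j) = Fintype.card β * blockMean y a := by
    rw [blockMean]; field_simp
  rw [blockMean]
  simp only [blockMeanReflection_apply, Finset.sum_sub_distrib, hs, Finset.sum_const,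
    Finset.card_univ, nsmul_eq_mul]
  field_simp
  ring

lemma blockMeanReflection_mem_blockCenteredLE [Nonempty β] (t : ℝ)
    (y : EuclideanSpace ℝ (α × β)) :
    blockMeanReflection y ∈ (blockCenteredLE t : Set (EuclideanSpace ℝ (α × β))) ↔
      y ∈ (blockCenteredLE t : Set (EuclideanSpace ℝ (α × β))) := by
  simp only [blockCenteredLE, Set.mem_ofPred_eq, blockMean_blockMeanReflection,
    blockMeanReflection_apply]
  refine forall_congr' fun p => ?_
  rw [show y p - 2 * blockMean y p.1 - -blockMean y p.1 = y p - blockMean y p.1 by ring]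

/-- Permutation of the coordinates within each block. -/
def blockPerm (σ : Equiv.Perm β) :
    EuclideanSpace ℝ (α × β) ≃ₗᵢ[ℝ] EuclideanSpace ℝ (α × β) :=
  LinearIsometryEquiv.piLpCongrLeft 2 ℝ ℝ ((Equiv.refl α).prodCongr σ.symm)

lemma blockPerm_apply (σ : Equiv.Perm β) (y : EuclideanSpace ℝ (α × β)) (p : α × β) :
    blockPerm σ y p = y (p.1, σ p.2) := by
  simp [blockPerm, LinearIsometryEquiv.piLpCongrLeft_apply, Equiv.piCongrLeft', Prod.map]

lemma blockPerm_mem_blockCenteredLE (σ : Equiv.Perm β) (t : ℝ)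
    (y : EuclideanSpace ℝ (α × β)) :
    blockPerm σ y ∈ (blockCenteredLE t : Set (EuclideanSpace ℝ (α × β))) ↔
      y ∈ (blockCenteredLE t : Set (EuclideanSpace ℝ (α × β))) := by
  have hm : ∀ a, blockMean (blockPerm σ y) a = blockMean y a := fun a => by
    simp only [blockMean, blockPerm_apply]
    rw [Equiv.sum_comp σ fun j => y (a, j)]
  simp only [blockCenteredLE, Set.mem_ofPred_eq, hm, blockPerm_apply, Prod.forall]
  exact forall_congr' fun a => σ.forall_congr_left.trans (by simp)

lemma integral_gaussTilt_blockCenteredLE [DecidableEq α] [Nonempty β] (t : ℝ) :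
    ∫ x, x ∂(gaussTilt ((blockCenteredLE t : Set (EuclideanSpace ℝ (α × β))).indicator 1)) =
      0 := by
  classical
  set K : Set (EuclideanSpace ℝ (α × β)) := blockCenteredLE t with hK
  have hF : IsBlockLogConcave Prod.fst (K.indicator 1) :=
    isBlockLogConcave_indicator_blockCenteredLE t
  by_cases h0 : ∫⁻ x, K.indicator 1 x ∂(stdGaussian (EuclideanSpace ℝ (α × β))) = 0
  · have : (stdGaussian (EuclideanSpace ℝ (α × β))).withDensity (K.indicator 1) = 0 := by
      rw [← Measure.measure_univ_eq_zero, withDensity_apply _ MeasurableSet.univ]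
      simpa using h0
    simp [gaussTilt, this]
  have := hF.isProbabilityMeasure h0
  have hint : Integrable (fun x : EuclideanSpace ℝ (α × β) => x) (gaussTilt (K.indicator 1)) :=
    (hF.memLp_id_gaussTilt h0).integrable (by norm_num)
  have hi : ∀ p, Integrable (fun x : EuclideanSpace ℝ (α × β) => x p)
      (gaussTilt (K.indicator 1)) := fun p =>
    (EuclideanSpace.proj (𝕜 := ℝ) p).integrable_comp hint
  have hcoord : ∀ p, (∫ x, x ∂(gaussTilt (K.indicator 1))) p =
      ∫ x : EuclideanSpace ℝ (α × β), x p ∂(gaussTilt (K.indicator 1)) := fun p =>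
    ((EuclideanSpace.proj (𝕜 := ℝ) p).integral_comp_comm hint).symm
  have hinv : ∀ f : EuclideanSpace ℝ (α × β) ≃ₗᵢ[ℝ] EuclideanSpace ℝ (α × β),
      (∀ y, f y ∈ K ↔ y ∈ K) → ∀ g : EuclideanSpace ℝ (α × β) → ℝ,
      ∫ x, g (f x) ∂(gaussTilt (K.indicator 1)) = ∫ x, g x ∂(gaussTilt (K.indicator 1)) :=
    fun f hf g => integral_comp_gaussTilt hF.measurable f
      (fun x => by simp [Set.indicator_apply, hf x]) g
  have hperm : ∀ a i j, ∫ x : EuclideanSpace ℝ (α × β), x (a, i) ∂(gaussTilt (K.indicator 1)) =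
      ∫ x : EuclideanSpace ℝ (α × β), x (a, j) ∂(gaussTilt (K.indicator 1)) := fun a i j => by
    have := hinv (blockPerm (Equiv.swap i j)) (blockPerm_mem_blockCenteredLE _ t)
      fun x => x (a, j)
    simpa [blockPerm_apply] using this
  have hmean : ∀ a, ∫ x, blockMean x a ∂(gaussTilt (K.indicator 1)) = 0 := fun a => by
    have := hinv blockMeanReflection (blockMeanReflection_mem_blockCenteredLE t)
      fun x => blockMean x a
    simp only [blockMean_blockMeanReflection, integral_neg] at this
    linarith
  ext ⟨a, i⟩
  rw [hcoord, PiLp.zero_apply]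
  have h := hmean a
  have hc : (Fintype.card β : ℝ) ≠ 0 := by exact_mod_cast Fintype.card_ne_zero
  simp only [blockMean] at h
  rw [integral_const_mul, integral_finsetSum _ fun j _ => hi (a, j),
    Finset.sum_congr rfl fun j _ => hperm a j i] at h
  simpa [hc] using h

end BlockCentering

section CenteredMax

variable {α β : Type*} [Fintype α] [Fintype β]

/-- The largest excess of a coordinate over the mean of its block. -/
def centeredMax (y : EuclideanSpace ℝ (α × β)) : ℝ :=
  ⨆ p : α × β, (y p - blockMean y p.1)

lemma measurable_centeredMax : Measurable (centeredMax (α := α) (β := β)) := by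
  refine Measurable.iSup fun p => ?_
  have := (continuous_blockMean (α := α) (β := β) p.1).measurable
  fun_prop

variable [Nonempty α] [Nonempty β]

lemma centeredMax_le_iff (y : EuclideanSpace ℝ (α × β)) (t : ℝ) :
    centeredMax y ≤ t ↔ y ∈ (blockCenteredLE t : Set (EuclideanSpace ℝ (α × β))) :=
  ciSup_le_iff (Set.finite_range _).bddAbove

omit [Fintype α] [Nonempty α] in
lemma sum_sub_blockMean (y : EuclideanSpace ℝ (α × β)) (a : α) :
    ∑ j, (y (a, j) - blockMean y a) = 0 := by
  have hc : (Fintype.card β : ℝ) ≠ 0 := by exact_mod_cast Fintype.card_ne_zero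
  simp only [Finset.sum_sub_distrib, Finset.sum_const, Finset.card_univ, nsmul_eq_mul, blockMean]
  field_simp
  ring

lemma centeredMax_nonneg (y : EuclideanSpace ℝ (α × β)) : 0 ≤ centeredMax y := by
  obtain ⟨a⟩ := ‹Nonempty α›
  by_contra! hlt
  have h := (centeredMax_le_iff y (centeredMax y)).1 le_rfl
  have : ∑ j, (y (a, j) - blockMean y a) < 0 :=
    Finset.sum_neg (fun j _ => (h (a, j)).trans_lt hlt) Finset.univ_nonempty
  exact this.ne (sum_sub_blockMean y a)

lemma integrable_centeredMax (μ : Measure (EuclideanSpace ℝ (α × β))) [IsGaussian μ] :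
    Integrable centeredMax μ := by
  have hid : Integrable (fun x : EuclideanSpace ℝ (α × β) => x) μ :=
    (IsGaussian.memLp_two_id (μ := μ)).integrable (by norm_num)
  have hi : ∀ p, Integrable (fun x : EuclideanSpace ℝ (α × β) => x p) μ := fun p =>
    (EuclideanSpace.proj (𝕜 := ℝ) p).integrable_comp hid
  have hb : ∀ a, Integrable (fun x : EuclideanSpace ℝ (α × β) => blockMean x a) μ := fun a =>
    (integrable_finsetSum _ fun j _ => hi (a, j)).const_mul _
  have hsum : Integrable (fun x : EuclideanSpace ℝ (α × β) =>
      ∑ p : α × β, |x p - blockMean x p.1|) μ :=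
    integrable_finsetSum _ fun p _ => ((hi p).sub (hb p.1)).abs
  refine hsum.mono' measurable_centeredMax.aestronglyMeasurable
    (Filter.Eventually.of_forall fun y => ?_)
  rw [Real.norm_of_nonneg (centeredMax_nonneg y)]
  exact ciSup_le fun p => (le_abs_self _).trans
    (Finset.single_le_sum (f := fun p : α × β => |y p - blockMean y p.1|)
      (fun q _ => abs_nonneg _) (Finset.mem_univ p))

variable [DecidableEq α] [DecidableEq β]

/-- Among centered Gaussian vectors with identity diagonal blocks, the standard one has the largest
expected centered maximum. -/
lemma integral_centeredMax_le {S : Matrix (α × β) (α × β) ℝ} (hS : S.PosSemidef)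
    (hSb : ∀ p q : α × β, p.1 = q.1 → S p q = (1 : Matrix (α × β) (α × β) ℝ) p q) :
    ∫ y, centeredMax y ∂(multivariateGaussian 0 S) ≤
      ∫ y, centeredMax y ∂(stdGaussian (EuclideanSpace ℝ (α × β))) := by
  have h0 : ∀ μ : Measure (EuclideanSpace ℝ (α × β)), 0 ≤ᵐ[μ] centeredMax := fun μ =>
    Filter.Eventually.of_forall centeredMax_nonneg
  have hm := measurable_centeredMax (α := α) (β := β)
  rw [integral_eq_lintegral_of_nonneg_ae (h0 _) hm.aestronglyMeasurable,
    integral_eq_lintegral_of_nonneg_ae (h0 _) hm.aestronglyMeasurable]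
  refine ENNReal.toReal_mono ?_ ?_
  · rw [← ofReal_integral_eq_lintegral_ofReal (integrable_centeredMax _) (h0 _)]
    exact ENNReal.ofReal_ne_top
  rw [lintegral_eq_lintegral_meas_lt _ (h0 _) hm.aemeasurable,
    lintegral_eq_lintegral_meas_lt _ (h0 _) hm.aemeasurable]
  refine lintegral_mono fun t => ?_
  have hset : {y : EuclideanSpace ℝ (α × β) | t < centeredMax y} = (blockCenteredLE t)ᶜ := by
    ext y
    rw [Set.mem_compl_iff, ← centeredMax_le_iff, not_le]
    rfl
  have hK := isClosed_blockCenteredLE (α := α) (β := β) t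
  rw [hset, prob_compl_eq_one_sub hK.measurableSet, prob_compl_eq_one_sub hK.measurableSet]
  exact tsub_le_tsub_left (stdGaussian_le_multivariateGaussian hS hSb hK
    (isBlockLogConcave_indicator_blockCenteredLE t) (integral_gaussTilt_blockCenteredLE t)) 1

end CenteredMax

section BlockGaussian

variable {α β : Type*} [Fintype α] [Fintype β] [DecidableEq α] [DecidableEq β]

/-- The block diagonal matrix averaging the coordinates in each block. -/
def blockAverage : Matrix (α × β) (α × β) ℝ :=
  Matrix.of fun p q => if p.1 = q.1 then (Fintype.card β : ℝ)⁻¹ else 0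

omit [DecidableEq β] in
lemma blockAverage_mulVec (y : EuclideanSpace ℝ (α × β)) (p : α × β) :
    ((blockAverage : Matrix (α × β) (α × β) ℝ) *ᵥ y) p = blockMean y p.1 := by
  simp only [blockAverage, mulVec, dotProduct, blockMean, Fintype.sum_prod_type_right,
    Finset.mul_sum, Matrix.of_apply, ite_mul, zero_mul, Finset.sum_ite_eq, Finset.mem_univ, if_true]

omit [Fintype α] [DecidableEq β] in
lemma transpose_blockAverage :
    (blockAverage : Matrix (α × β) (α × β) ℝ)ᵀ = blockAverage := by
  ext p q
  simp [blockAverage, eq_comm]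

omit [DecidableEq β] in
lemma blockAverage_mul_self [Nonempty β] :
    (blockAverage : Matrix (α × β) (α × β) ℝ) * blockAverage = blockAverage := by
  have hc : (Fintype.card β : ℝ) ≠ 0 := by exact_mod_cast Fintype.card_ne_zero
  ext p q
  by_cases h : p.1 = q.1 <;> simp [blockAverage, mul_apply, Fintype.sum_prod_type_right, hc, h]

omit [DecidableEq β] in
lemma posSemidef_blockAverage [Nonempty β] :
    (blockAverage : Matrix (α × β) (α × β) ℝ).PosSemidef := by
  have := posSemidef_self_mul_conjTranspose (blockAverage : Matrix (α × β) (α × β) ℝ)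
  rwa [conjTranspose_eq_transpose_of_trivial, transpose_blockAverage, blockAverage_mul_self]
    at this

variable {κ : Type*} [Fintype κ] [DecidableEq κ] [Nonempty β]

omit [DecidableEq κ] in
lemma blockAverage_mul_eq_zero {L : Matrix (α × β) κ ℝ}
    (hL : ∀ a i j, (L * Lᵀ) (a, i) (a, j) = (1 : Matrix β β ℝ) i j - (Fintype.card β : ℝ)⁻¹) :
    (blockAverage : Matrix (α × β) (α × β) ℝ) * L = 0 := by
  have hc : (Fintype.card β : ℝ) ≠ 0 := by exact_mod_cast Fintype.card_ne_zero
  have hs : ∀ a k, ∑ i, L (a, i) k = 0 := by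
    intro a
    have h : ∑ k, (∑ i, L (a, i) k) ^ 2 = 0 := by
      calc ∑ k, (∑ i, L (a, i) k) ^ 2
          = ∑ i, ∑ j, (L * Lᵀ) (a, i) (a, j) := by
            simp only [sq, Finset.sum_mul_sum, mul_apply, transpose_apply]
            rw [Finset.sum_comm]
            exact Finset.sum_congr rfl fun i _ => Finset.sum_comm
        _ = 0 := by
            simp only [hL, Finset.sum_sub_distrib, Matrix.one_apply]
            simp [hc]
    intro k
    exact pow_eq_zero_iff (two_ne_zero) |>.1
      ((Finset.sum_eq_zero_iff_of_nonneg fun k _ => sq_nonneg _).1 h k (Finset.mem_univ k))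
  ext p k
  simp [blockAverage, mul_apply, Fintype.sum_prod_type_right, ← Finset.mul_sum, hs]

lemma measurable_toLp_mulVec {m n : Type*} [Fintype m] [Fintype n] (A : Matrix m n ℝ) :
    Measurable fun x : EuclideanSpace ℝ n =>
      (WithLp.toLp 2 (A *ᵥ x.ofLp) : EuclideanSpace ℝ m) := by
  refine Continuous.measurable ?_
  have : Continuous fun x : EuclideanSpace ℝ n => A *ᵥ x.ofLp :=
    continuous_const.matrix_mulVec (by fun_prop)
  fun_prop

omit [DecidableEq κ] in
/-- A Gaussian vector with centered blocks is obtained by centering a Gaussian vector with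
identity diagonal blocks. -/
lemma map_toLpLin_stdGaussian {L : Matrix (α × β) κ ℝ}
    (hL : ∀ a i j, (L * Lᵀ) (a, i) (a, j) = (1 : Matrix β β ℝ) i j - (Fintype.card β : ℝ)⁻¹) :
    (stdGaussian (EuclideanSpace ℝ κ)).map (fun x => WithLp.toLp 2 (L *ᵥ x.ofLp)) =
      (multivariateGaussian 0 (L * Lᵀ + blockAverage)).map
        (fun y => WithLp.toLp 2 ((1 - blockAverage) *ᵥ y.ofLp)) := by
  have hPSD : (L * Lᵀ + blockAverage).PosSemidef := by
    have := posSemidef_self_mul_conjTranspose L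
    rw [conjTranspose_eq_transpose_of_trivial] at this
    exact this.add posSemidef_blockAverage
  have hm1 := measurable_toLp_mulVec L
  have hm2 := measurable_toLp_mulVec (1 - blockAverage : Matrix (α × β) (α × β) ℝ)
  have := Measure.isProbabilityMeasure_map (μ := stdGaussian (EuclideanSpace ℝ κ)) hm1.aemeasurable
  have := Measure.isProbabilityMeasure_map
    (μ := multivariateGaussian 0 (L * Lᵀ + blockAverage)) hm2.aemeasurable
  refine Measure.ext_of_charFun (funext fun ξ => ?_)
  have e1 : ∀ x : EuclideanSpace ℝ κ,
      ⟪(WithLp.toLp 2 (L *ᵥ x.ofLp) : EuclideanSpace ℝ (α × β)), ξ⟫ =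
        ⟪x, WithLp.toLp 2 (Lᵀ *ᵥ ξ.ofLp)⟫ := fun x => by
    simp only [EuclideanSpace.inner_eq_star_dotProduct, star_trivial]
    rw [dotProduct_mulVec, ← mulVec_transpose]
  have hPt : (1 - blockAverage : Matrix (α × β) (α × β) ℝ)ᵀ = 1 - blockAverage := by
    rw [transpose_sub, transpose_one, transpose_blockAverage]
  have e2 : ∀ y : EuclideanSpace ℝ (α × β),
      ⟪(WithLp.toLp 2 ((1 - blockAverage) *ᵥ y.ofLp) : EuclideanSpace ℝ (α × β)), ξ⟫ =
        ⟪y, WithLp.toLp 2 ((1 - blockAverage) *ᵥ ξ.ofLp)⟫ := fun y => by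
    simp only [EuclideanSpace.inner_eq_star_dotProduct, star_trivial]
    rw [dotProduct_mulVec, ← mulVec_transpose, hPt]
  rw [charFun_apply, charFun_apply, integral_map hm1.aemeasurable (by fun_prop),
    integral_map hm2.aemeasurable (by fun_prop)]
  simp only [e1, e2]
  rw [← charFun_apply, ← charFun_apply, charFun_stdGaussian, charFun_multivariateGaussian hPSD]
  have hJL := blockAverage_mul_eq_zero hL
  have hLJ : Lᵀ * (blockAverage : Matrix (α × β) (α × β) ℝ) = 0 := by
    rw [← transpose_blockAverage, ← transpose_mul, hJL, transpose_zero]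
  have hmat : (1 - blockAverage : Matrix (α × β) (α × β) ℝ) *
      ((L * Lᵀ + blockAverage) * (1 - blockAverage)) = L * Lᵀ := by
    have h1 : (L * Lᵀ + blockAverage) * (1 - blockAverage : Matrix (α × β) (α × β) ℝ) = L * Lᵀ := by
      rw [mul_sub, mul_one, add_mul, Matrix.mul_assoc, hLJ, Matrix.mul_zero, blockAverage_mul_self]
      abel
    rw [h1, sub_mul, one_mul, ← Matrix.mul_assoc, hJL, Matrix.zero_mul, sub_zero]
  have hq : ((1 - blockAverage) *ᵥ ξ.ofLp) ⬝ᵥ (L * Lᵀ + blockAverage) *ᵥ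
      (1 - blockAverage) *ᵥ ξ.ofLp = ‖(WithLp.toLp 2 (Lᵀ *ᵥ ξ.ofLp) : EuclideanSpace ℝ κ)‖ ^ 2 := by
    rw [mulVec_mulVec, dotProduct_comm, dotProduct_mulVec, ← mulVec_transpose, hPt, mulVec_mulVec,
      hmat, ← mulVec_mulVec, dotProduct_comm, dotProduct_mulVec, ← mulVec_transpose,
      EuclideanSpace.real_norm_sq_eq]
    simp [dotProduct, sq]
  rw [hq]
  congr 1
  simp
  ring

end BlockGaussian

section Width

variable {α β κ : Type*} [Fintype α] [Fintype β] [Fintype κ] [DecidableEq α] [DecidableEq β]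
  [DecidableEq κ] [Nonempty β]

omit [DecidableEq κ] in
lemma integral_iSup_mulVec {Ω : Type*} [MeasurableSpace Ω] {μ : Measure Ω} {g : Ω → κ → ℝ}
    (hg : Measurable g) (hμ : μ.map g = Measure.pi fun _ => gaussianReal 0 1)
    {L : Matrix (α × β) κ ℝ}
    (hL : ∀ a i j, (L * Lᵀ) (a, i) (a, j) = (1 : Matrix β β ℝ) i j - (Fintype.card β : ℝ)⁻¹) :
    ∫ ω, (⨆ p, (L *ᵥ g ω) p) ∂μ =
      ∫ y, centeredMax y ∂(multivariateGaussian 0 (L * Lᵀ + blockAverage)) := by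
  have hsup : StronglyMeasurable fun z : EuclideanSpace ℝ (α × β) => ⨆ p, z p :=
    (Measurable.iSup fun p => by fun_prop).stronglyMeasurable
  have hY : (μ.map g).map (WithLp.toLp 2) = stdGaussian (EuclideanSpace ℝ κ) := by
    rw [hμ, map_pi_eq_stdGaussian]
  have hc : ∀ y : EuclideanSpace ℝ (α × β), centeredMax y =
      ⨆ p, ((WithLp.toLp 2 ((1 - blockAverage) *ᵥ y.ofLp) : EuclideanSpace ℝ (α × β))) p := by
    intro y
    refine iSup_congr fun p => ?_
    rw [sub_mulVec, one_mulVec]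
    simp [blockAverage_mulVec]
  have h1 := integral_map (μ := multivariateGaussian 0 (L * Lᵀ + blockAverage))
    (measurable_toLp_mulVec (1 - blockAverage)).aemeasurable hsup.aestronglyMeasurable
  have h2 := integral_map (μ := stdGaussian (EuclideanSpace ℝ κ))
    (measurable_toLp_mulVec L).aemeasurable hsup.aestronglyMeasurable
  simp only [hc]
  rw [← h1, ← map_toLpLin_stdGaussian hL, h2, ← hY,
    Measure.map_map (by fun_prop) hg]
  exact (integral_map (f := fun x : EuclideanSpace ℝ κ => ⨆ p, (L *ᵥ x.ofLp) p)
    ((by fun_prop : Measurable (WithLp.toLp 2 : (κ → ℝ) → EuclideanSpace ℝ κ)).comp hg).aemeasurable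
    (hsup.comp_measurable (measurable_toLp_mulVec L)).aestronglyMeasurable).symm

end Width

section Hamiltonian

variable {d : ℕ}

lemma inner_toLp_matrix (A B : Matrix (Fin d) (Fin d) ℂ) :
    inner ℂ (WithLp.toLp 2 fun p : Fin d × Fin d => A p.1 p.2)
      (WithLp.toLp 2 fun p : Fin d × Fin d => B p.1 p.2) = (Aᴴ * B).trace := by
  rw [EuclideanSpace.inner_eq_star_dotProduct]
  simp only [dotProduct, Fintype.sum_prod_type_right, trace, diag_apply, mul_apply,
    conjTranspose_apply, Pi.star_apply]
  exact Finset.sum_congr rfl fun i _ => Finset.sum_congr rfl fun j _ => mul_comm _ _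

/-- Parseval's identity for an orthonormal basis of the traceless Hermitian matrices. -/
lemma sum_trace_mul_trace (hd : 1 ≤ d) {E : Fin (d ^ 2 - 1) → Matrix (Fin d) (Fin d) ℂ}
    (hE : ∀ k, (E k).IsHermitian) (hE0 : ∀ k, (E k).trace = 0)
    (hE1 : ∀ k l, (E k * E l).trace = if k = l then (1 : ℂ) else 0)
    {M N : Matrix (Fin d) (Fin d) ℂ} (hM : M.IsHermitian) (hN : N.trace = 0) :
    ∑ k, (E k * M).trace * (E k * N).trace = (M * N).trace := by
  have hd0 : (d : ℝ) ≠ 0 := by positivity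
  let A : Option (Fin (d ^ 2 - 1)) → Matrix (Fin d) (Fin d) ℂ :=
    fun o => o.elim ((((√d)⁻¹ : ℝ) : ℂ) • 1) E
  let v : Option (Fin (d ^ 2 - 1)) → EuclideanSpace ℂ (Fin d × Fin d) :=
    fun o => WithLp.toLp 2 fun p => A o p.1 p.2
  have hA : ∀ o, (A o)ᴴ = A o := by
    rintro (_ | k)
    · simp [A, conjTranspose_smul]
    · exact hE k
  have hv : Orthonormal ℂ v := by
    classical
    rw [orthonormal_iff_ite]
    intro o o'
    simp only [v, inner_toLp_matrix, hA]
    rcases o with _ | k <;> rcases o' with _ | l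
    · simp only [A, Option.elim_none, if_true, smul_mul_smul_comm, mul_one, trace_smul, trace_one,
        Fintype.card_fin, smul_eq_mul]
      norm_cast
      rw [← mul_inv, Real.mul_self_sqrt (by positivity), inv_mul_cancel₀ hd0]
    · simp [A, hE0]
    · simp [A, hE0]
    · simp [A, hE1]
  have hcard : Fintype.card (Option (Fin (d ^ 2 - 1))) =
      Module.finrank ℂ (EuclideanSpace ℂ (Fin d × Fin d)) := by
    have : 1 ≤ d ^ 2 := Nat.one_le_pow _ _ hd
    simp only [Fintype.card_option, Fintype.card_fin, finrank_euclideanSpace, Fintype.card_prod]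
    rw [← sq]
    omega
  let B := (basisOfOrthonormalOfCardEqFinrank hv hcard).toOrthonormalBasis (by
    simpa using hv)
  have hB : ∀ o, B o = v o := fun o => by simp [B]
  have h := B.sum_inner_mul_inner (WithLp.toLp 2 fun p : Fin d × Fin d => M p.1 p.2)
    (WithLp.toLp 2 fun p : Fin d × Fin d => N p.1 p.2)
  simp only [hB, v, inner_toLp_matrix, hA, hM.eq, Fintype.sum_option] at h
  rw [← h]
  simp [A, hN, trace_mul_comm M]

lemma im_trace_mul_of_isHermitian {M N : Matrix (Fin d) (Fin d) ℂ} (hM : M.IsHermitian)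
    (hN : N.IsHermitian) : (M * N).trace.im = 0 := by
  rw [← Complex.conj_eq_iff_im]
  change star _ = _
  rw [← trace_conjTranspose, conjTranspose_mul, hM.eq, hN.eq, trace_mul_comm]

lemma isHermitian_Qmat (ψ : Fin d → ℂ) : (Qmat ψ).IsHermitian := by
  simp [Qmat, Matrix.IsHermitian, conjTranspose_sub, conjTranspose_smul, conjTranspose_vecMulVec]

lemma trace_Qmat (hd : 1 ≤ d) {ψ : Fin d → ℂ} (hψ : star ψ ⬝ᵥ ψ = 1) : (Qmat ψ).trace = 0 := by
  have hd0 : (d : ℂ) ≠ 0 := by exact_mod_cast (by omega : d ≠ 0)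
  rw [Qmat, trace_sub, trace_vecMulVec, dotProduct_comm, hψ, trace_smul, trace_one]
  simp [hd0]

lemma trace_Qmat_mul_Qmat (hd : 1 ≤ d) {ψ φ : Fin d → ℂ} (hψ : star ψ ⬝ᵥ ψ = 1)
    (hφ : star φ ⬝ᵥ φ = 1) :
    (Qmat ψ * Qmat φ).trace = ((Complex.normSq (star ψ ⬝ᵥ φ) - (d : ℝ)⁻¹ : ℝ) : ℂ) := by
  have hstar : star φ ⬝ᵥ ψ = star (star ψ ⬝ᵥ φ) := star_dotProduct _ _
  have h0 := trace_Qmat hd hφ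
  have e : Qmat ψ * Qmat φ = vecMulVec ψ (star ψ) * vecMulVec φ (star φ) -
      (d : ℂ)⁻¹ • vecMulVec ψ (star ψ) - (d : ℂ)⁻¹ • Qmat φ := by
    simp only [Qmat, sub_mul, mul_sub, smul_mul_assoc, one_mul, mul_smul_comm, mul_one, smul_sub]
    abel
  rw [e, trace_sub, trace_sub, trace_smul, trace_smul, h0, vecMulVec_mul_vecMulVec,
    trace_vecMulVec, trace_vecMulVec, dotProduct_smul, dotProduct_comm ψ, dotProduct_comm ψ, hψ,
    hstar, smul_eq_mul, Complex.star_def, Complex.mul_conj]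
  simp

/-- The coefficients of the centered projections in an orthonormal basis. -/
def overlapMatrix (E : Fin (d ^ 2 - 1) → Matrix (Fin d) (Fin d) ℂ)
    (S : Fin (d + 1) → Fin d → Fin d → ℂ) :
    Matrix (Fin (d + 1) × Fin d) (Fin (d ^ 2 - 1)) ℝ :=
  Matrix.of fun p k => (E k * Qmat (S p.1 p.2)).trace.re

lemma overlapMatrix_mul_transpose (hd : 1 ≤ d)
    {E : Fin (d ^ 2 - 1) → Matrix (Fin d) (Fin d) ℂ}
    (hE : ∀ k, (E k).IsHermitian) (hE0 : ∀ k, (E k).trace = 0)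
    (hE1 : ∀ k l, (E k * E l).trace = if k = l then (1 : ℂ) else 0)
    {S : Fin (d + 1) → Fin d → Fin d → ℂ} (hS : ∀ a, IsONB (S a))
    (p q : Fin (d + 1) × Fin d) :
    (overlapMatrix E S * (overlapMatrix E S)ᵀ) p q =
      Complex.normSq (star (S p.1 p.2) ⬝ᵥ S q.1 q.2) - (d : ℝ)⁻¹ := by
  have hn : ∀ p : Fin (d + 1) × Fin d, star (S p.1 p.2) ⬝ᵥ S p.1 p.2 = 1 := fun p => by
    simpa using hS p.1 p.2 p.2
  have h := sum_trace_mul_trace hd hE hE0 hE1 (isHermitian_Qmat (S p.1 p.2))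
    (trace_Qmat hd (hn q))
  rw [trace_Qmat_mul_Qmat hd (hn p) (hn q)] at h
  have h' := congrArg Complex.re h
  rw [Complex.ofReal_re, Complex.re_sum] at h'
  rw [← h']
  simp only [mul_apply, transpose_apply, overlapMatrix, Matrix.of_apply]
  refine Finset.sum_congr rfl fun k _ => ?_
  rw [Complex.mul_re, im_trace_mul_of_isHermitian (hE k) (isHermitian_Qmat _)]
  simp

lemma overlapMatrix_mul_transpose_same (hd : 1 ≤ d)
    {E : Fin (d ^ 2 - 1) → Matrix (Fin d) (Fin d) ℂ}
    (hE : ∀ k, (E k).IsHermitian) (hE0 : ∀ k, (E k).trace = 0)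
    (hE1 : ∀ k l, (E k * E l).trace = if k = l then (1 : ℂ) else 0)
    {S : Fin (d + 1) → Fin d → Fin d → ℂ} (hS : ∀ a, IsONB (S a))
    (a : Fin (d + 1)) (i j : Fin d) :
    (overlapMatrix E S * (overlapMatrix E S)ᵀ) (a, i) (a, j) =
      (1 : Matrix (Fin d) (Fin d) ℝ) i j - (Fintype.card (Fin d) : ℝ)⁻¹ := by
  rw [overlapMatrix_mul_transpose hd hE hE0 hE1 hS, hS a i j, Matrix.one_apply, Fintype.card_fin]
  split_ifs <;> simp

lemma re_trace_sum_smul_mul (E : Fin (d ^ 2 - 1) → Matrix (Fin d) (Fin d) ℂ)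
    (S : Fin (d + 1) → Fin d → Fin d → ℂ) (x : Fin (d ^ 2 - 1) → ℝ) (p : Fin (d + 1) × Fin d) :
    ((∑ k, (x k : ℂ) • E k) * Qmat (S p.1 p.2)).trace.re = (overlapMatrix E S *ᵥ x) p := by
  simp only [Finset.sum_mul, trace_sum, smul_mul_assoc, trace_smul, smul_eq_mul, Complex.re_sum,
    Complex.re_ofReal_mul, mulVec, dotProduct, overlapMatrix, Matrix.of_apply]
  exact Finset.sum_congr rfl fun k _ => mul_comm _ _

end Hamiltonian

/-- The complete MUB ensemble maximizes the isotropic random-Hamiltonian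
Gaussian width `W(S) = E_H max_{ψ∈S} Tr(H Q_ψ)` among labelled unions of `d+1`
orthonormal bases: `W(S) ≤ W(M)`. -/
theorem mub_gaussian_width_optimal {d : ℕ} (hd : 2 ≤ d)
    (B : Fin (d + 1) → Fin d → Fin d → ℂ) (hB : IsCompleteMUB B)
    (S : Fin (d + 1) → Fin d → Fin d → ℂ) (hS : ∀ a, IsONB (S a))
    {Ω : Type*} [MeasurableSpace Ω] (μ : Measure Ω) [IsProbabilityMeasure μ]
    (H : Ω → Matrix (Fin d) (Fin d) ℂ) (hH : IsStdGaussianHamiltonian μ H) :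
    (∫ ω, (⨆ p : Fin (d + 1) × Fin d, ((H ω * Qmat (S p.1 p.2)).trace).re) ∂μ) ≤
      ∫ ω, (⨆ p : Fin (d + 1) × Fin d, ((H ω * Qmat (B p.1 p.2)).trace).re) ∂μ := by
  obtain ⟨E, g, hE, hE0, hE1, hg, hgμ, hH⟩ := hH
  have hd1 : 1 ≤ d := by omega
  have : Nonempty (Fin d) := ⟨⟨0, by omega⟩⟩
  simp only [hH, re_trace_sum_smul_mul]
  have hSd := overlapMatrix_mul_transpose_same hd1 hE hE0 hE1 hS
  have hBd := overlapMatrix_mul_transpose_same hd1 hE hE0 hE1 hB.1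
  rw [integral_iSup_mulVec hg hgμ hSd, integral_iSup_mulVec hg hgμ hBd]
  have hB1 : overlapMatrix E B * (overlapMatrix E B)ᵀ + blockAverage = 1 := by
    ext ⟨a, i⟩ ⟨b, j⟩
    rw [Matrix.add_apply]
    by_cases hab : a = b
    · subst hab
      rw [hBd]
      simp [blockAverage, Matrix.one_apply]
    · rw [overlapMatrix_mul_transpose hd1 hE hE0 hE1 hB.1, hB.2 a b i j hab]
      simp [blockAverage, hab]
  rw [hB1, multivariateGaussian_zero_one]
  refine integral_centeredMax_le ?_ ?_
  · have := posSemidef_self_mul_conjTranspose (overlapMatrix E S)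
    rw [conjTranspose_eq_transpose_of_trivial] at this
    exact this.add posSemidef_blockAverage
  · rintro ⟨a, i⟩ ⟨b, j⟩ hab
    obtain rfl : a = b := hab
    rw [Matrix.add_apply, hSd]
    simp [blockAverage, Matrix.one_apply]
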